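/- arXiv:2508.03150 — 3 statements merged into one kernel-verified Lean document; each statement's English description precedes it below -/
import Mathlib

section
/- Giambelli formula for the ninth variation of skew Schur functions: Let R be a commutative ring, N a positive integer, U an N×N upper unitriangular matrix over R, and r an integer with 0 ≤ r ≤ N. Let λ ⊇ μ be partitions with ℓ(λ) ≤ r and λ_1 ≤ N−r, written in Frobenius notation as λ = (α|β) with α_1 > ⋯ > α_p ≥ 0, β_1 > ⋯ > β_p ≥ 0, and μ = (γ|δ) with γ_1 > ⋯ > γ_q ≥ 0, δ_1 > ⋯ > δ_q ≥ 0. Then S^{(r)}_{λ/μ}(U) = (−1)^q · det G, where G is the (p+q)×(p+q) block matrix whose top-left p×p block has (i,j) entry S^{(r)}_{(α_i|β_j)}(U) (here (α_i|β_j) denotes the hook partition (α_i+1, 1^{β_j})), whose top-right p×q block has (i,j) entry h^{(r+γ_j+1)}_{α_i−γ_j}(U), whose bottom-left q×p block has (i,j) entry e^{(r−δ_i−1)}_{β_j−δ_i}(U), and whose bottom-right q×q block is the zero matrix. -/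
open Matrix BigOperators Finset Filter

/-- Extend a `Fin N`-indexed matrix to `ℕ` indices by zero. -/
def matExt {R : Type*} [Zero R] {N : ℕ} (U : Matrix (Fin N) (Fin N) R) : ℕ → ℕ → R :=
  fun i j => if hi : i < N then (if hj : j < N then U ⟨i, hi⟩ ⟨j, hj⟩ else 0) else 0

/-- `U` is upper unitriangular. -/
def UpperUni {R : Type*} [Zero R] [One R] {N : ℕ} (U : Matrix (Fin N) (Fin N) R) : Prop :=
  (∀ i, U i i = 1) ∧ ∀ i j : Fin N, (j : ℕ) < (i : ℕ) → U i j = 0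

/-- `L` is lower unitriangular. -/
def LowerUni {R : Type*} [Zero R] [One R] {N : ℕ} (L : Matrix (Fin N) (Fin N) R) : Prop :=
  (∀ i, L i i = 1) ∧ ∀ i j : Fin N, (i : ℕ) < (j : ℕ) → L i j = 0

/-- 0-based entries of the Maya diagram `J(λ;r)` (the `a`-th smallest element, minus 1):
for `a = 0,…,r-1` this is `λ_{r-a} + a` (with `λ` 0-based). -/
def maya (lam : ℕ → ℕ) (r : ℕ) (a : Fin r) : ℕ := lam (r - 1 - (a : ℕ)) + (a : ℕ)

/-- The ninth variation of the skew Schur function `S^{(r)}_{λ/μ}(U)`: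
the minor of `U` on rows `J(μ;r)` and columns `J(λ;r)`. -/
def SchurV {R : Type*} [CommRing R] {N : ℕ} (U : Matrix (Fin N) (Fin N) R)
    (r : ℕ) (lam mu : ℕ → ℕ) : R :=
  Matrix.det (Matrix.of fun i j : Fin r => matExt U (maya mu r i) (maya lam r j))

/-- Conjugate partition (0-based), counting parts among indices `< B`. -/
def conjF (f : ℕ → ℕ) (B : ℕ) : ℕ → ℕ :=
  fun i => ((Finset.range B).filter fun j => i + 1 ≤ f j).card

/-- The hook partition `(a+1, 1^b)` (0-based function). -/
def hookP (a b : ℕ) : ℕ → ℕ := fun k => if k = 0 then a + 1 else if k ≤ b then 1 else 0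

/-- `h^{(r)}_d(U) = S^{(r)}_{(d)}(U)`, zero for `d < 0`. -/
def hSV {R : Type*} [CommRing R] {N : ℕ} (U : Matrix (Fin N) (Fin N) R) (r : ℕ) (d : ℤ) : R :=
  if 0 ≤ d then SchurV U r (fun k => if k = 0 then d.toNat else 0) (fun _ => 0) else 0

/-- `e^{(r)}_d(U) = S^{(r)}_{(1^d)}(U)`, zero for `d < 0`. -/
def eSV {R : Type*} [CommRing R] {N : ℕ} (U : Matrix (Fin N) (Fin N) R) (r : ℕ) (d : ℤ) : R :=
  if 0 ≤ d then SchurV U r (fun k => if k < d.toNat then 1 else 0) (fun _ => 0) else 0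

/-- The partition with Frobenius coordinates `(a|b)` (all 0-based as functions). -/
def frobP (p : ℕ) (a b : Fin p → ℕ) : ℕ → ℕ :=
  fun i => if h : i < p then a ⟨i, h⟩ + i + 1
    else (Finset.univ.filter fun j : Fin p => i < b j + (j : ℕ) + 1).card

/-- `f : ℕ → ℤ` is a partition of length `≤ B`. -/
def IsPartZ (B : ℕ) (f : ℕ → ℤ) : Prop :=
  (∀ i, f (i + 1) ≤ f i) ∧ (∀ i, 0 ≤ f i) ∧ (∀ i, B ≤ i → f i = 0)

/-- `lam/mu` is a skew partition (of length `≤ B`). -/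
def IsSkewZ (B : ℕ) (lam mu : ℕ → ℤ) : Prop :=
  IsPartZ B lam ∧ IsPartZ B mu ∧ ∀ i, mu i ≤ lam i

open Classical in
/-- `S^{(r)}_{λ/μ}(U)` with the convention that it is `0` if `λ/μ` is not a skew partition. -/
noncomputable def SchurVz {R : Type*} [CommRing R] {N : ℕ} (U : Matrix (Fin N) (Fin N) R)
    (r B : ℕ) (lam mu : ℕ → ℤ) : R :=
  if IsSkewZ B lam mu then SchurV U r (fun i => (lam i).toNat) (fun i => (mu i).toNat) else 0

open Classical in
/-- `S^{(r)}_{λ'/μ'}(U)` applied to the conjugates, with the zero convention. -/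
noncomputable def SchurVzConj {R : Type*} [CommRing R] {N : ℕ} (U : Matrix (Fin N) (Fin N) R)
    (r B : ℕ) (lam mu : ℕ → ℤ) : R :=
  if IsSkewZ B lam mu then
    SchurV U r (conjF (fun i => (lam i).toNat) B) (conjF (fun i => (mu i).toNat) B) else 0

/-- `lam/mu` is a skew partition (ℕ-valued version). -/
def IsSkewN (B : ℕ) (lam mu : ℕ → ℕ) : Prop :=
  (∀ i, lam (i + 1) ≤ lam i) ∧ (∀ i, mu (i + 1) ≤ mu i) ∧ (∀ i, mu i ≤ lam i) ∧
    (∀ i, B ≤ i → lam i = 0)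

open Classical in
noncomputable def SchurVn {R : Type*} [CommRing R] {N : ℕ} (U : Matrix (Fin N) (Fin N) R)
    (r B : ℕ) (lam mu : ℕ → ℕ) : R :=
  if IsSkewN B lam mu then SchurV U r lam mu else 0

/-- The rectangular partition `[m|n] = (n^m)`. -/
def rectP (m n : ℕ) : ℕ → ℕ := fun i => if i < m then n else 0

/-- `[m|n]^l = ((n+1)^l, n^{m-l})`. -/
def rectUpP (m n l : ℕ) : ℕ → ℕ := fun i => if i < l then n + 1 else if i < m then n else 0

/-- `[m|n]_k = (n^m, k)`. -/
def rectLowP (m n k : ℕ) : ℕ → ℕ := fun i => if i < m then n else if i = m then k else 0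

/-- `E + c·E_{t,t+1}` (indices 0-based). -/
def elemMat {R : Type*} [CommRing R] (N t : ℕ) (c : R) : Matrix (Fin N) (Fin N) R :=
  1 + Matrix.of (fun i j : Fin N => if (i : ℕ) = t ∧ (j : ℕ) = t + 1 then c else 0)

/-- `U = U_1 ⋯ U_M` with `U_k = (E + w_{k,1-r}E_{1,2}) ⋯ (E + w_{k,N-1-r}E_{N-1,N})`. -/
def UmatW {R : Type*} [CommRing R] (N M : ℕ) (r : ℤ) (w : ℕ → ℤ → R) :
    Matrix (Fin N) (Fin N) R :=
  ((List.range M).map fun k =>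
    ((List.range (N - 1)).map fun t => elemMat N t (w (k + 1) ((t : ℤ) + 1 - r))).prod).prod

/-- The partition `(m_1^{r_1} m_2^{r_2-r_1} ⋯ m_n^{r_n-r_{n-1}})` (corner data 0-based). -/
def stepPart (n : ℕ) (m rr : ℕ → ℕ) : ℕ → ℕ :=
  fun i =>
    if h : (((Finset.range n).filter fun j => i < rr j)).Nonempty then
      m (((Finset.range n).filter fun j => i < rr j).min' h)
    else 0

/-- `Add_{a,b}` (rows 1-based in `a`, `b`; the function argument is 0-based). -/
def AddOp (a b : ℕ) (k : ℕ → ℕ) : ℕ → ℕ := fun i =>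
  if i + 1 ≤ a then k i
  else if i + 1 = a + 1 then k (a - 1)
  else if i + 1 ≤ b + 1 then k (i - 1) + 1
  else k i

/-- `Rem_{a,b}`. -/
def RemOp (a b : ℕ) (k : ℕ → ℕ) : ℕ → ℕ := fun i =>
  if i + 1 < a then k i
  else if i + 1 ≤ b - 1 then k (i + 1) - 1
  else if i + 1 = b then k b
  else k i

/-- `op_{a 0, b 0} ∘ op_{a 1, b 1} ∘ ⋯ ∘ op_{a (t-1), b (t-1)}` applied to `k`. -/
def iterOp (op : ℕ → ℕ → (ℕ → ℕ) → ℕ → ℕ) (t : ℕ) (a b : ℕ → ℕ) (k : ℕ → ℕ) : ℕ → ℕ :=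
  (List.range t).foldr (fun i acc => op (a i) (b i) acc) k

/-- the `i`-th smallest element of a finite set of naturals (0-based). -/
def ascNth (s : Finset ℕ) (i : ℕ) : ℕ := (s.sort (· ≤ ·)).getD i 0

/-- The cells of the skew Young diagram `D(λ/μ)` (0-based, rows `< B`). -/
def cellsD (B : ℕ) (lam mu : ℕ → ℕ) : Finset (ℕ × ℕ) :=
  (Finset.range B ×ˢ Finset.range (lam 0 + 1)).filter fun p => mu p.1 ≤ p.2 ∧ p.2 < lam p.1

/-- Semistandardness: weakly increasing along rows, strictly increasing down columns. -/
def IsSSYT {M B : ℕ} {lam mu : ℕ → ℕ} (T : ↥(cellsD B lam mu) → Fin M) : Prop :=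
  (∀ c c' : ↥(cellsD B lam mu), c.val.1 = c'.val.1 → c.val.2 ≤ c'.val.2 → T c ≤ T c') ∧
  (∀ c c' : ↥(cellsD B lam mu), c.val.1 < c'.val.1 → c.val.2 = c'.val.2 → T c < T c')

open Classical in
/-- Sum over all semistandard tableaux of shape `λ/μ` with entries in `{1,…,M}` of
the product over cells `c` of `f (entry) c`. -/
noncomputable def tabSum {R : Type*} [CommRing R] (M B : ℕ) (lam mu : ℕ → ℕ)
    (f : ℕ → ℕ × ℕ → R) : R :=
  ∑ T ∈ Finset.univ.filter (fun T : ↥(cellsD B lam mu) → Fin M => IsSSYT T),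
    ∏ c : ↥(cellsD B lam mu), f ((T c : ℕ) + 1) c.val

/-- `M`-truncated Schur multiple zeta value for a general filling `s` of the diagram. -/
noncomputable def zetaTF (M B : ℕ) (lam mu : ℕ → ℕ) (s : ℕ × ℕ → ℂ) : ℂ :=
  tabSum M B lam mu fun k c => (k : ℂ) ^ (-(s c))

/-- `M`-truncated diagonally constant Schur multiple zeta value `ζ^M_{λ/μ}(a)`. -/
noncomputable def zetaT (M B : ℕ) (lam mu : ℕ → ℕ) (a : ℤ → ℂ) : ℂ :=
  zetaTF M B lam mu fun c => a ((c.2 : ℤ) - (c.1 : ℤ))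

open Classical in
/-- `ζ^M_{λ/μ}(a)` with the zero convention for non-skew shapes. -/
noncomputable def zetaZ (M B : ℕ) (lam mu : ℕ → ℤ) (a : ℤ → ℂ) : ℂ :=
  if IsSkewZ B lam mu then
    zetaT M B (fun i => (lam i).toNat) (fun i => (mu i).toNat) a else 0

open Classical in
/-- `ζ^M_{λ'/μ'}(a)` applied to conjugates, with the zero convention. -/
noncomputable def zetaZConj (M B : ℕ) (lam mu : ℕ → ℤ) (a : ℤ → ℂ) : ℂ :=
  if IsSkewZ B lam mu then
    zetaT M (lam 0).toNat (conjF (fun i => (lam i).toNat) B)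
      (conjF (fun i => (mu i).toNat) B) a
  else 0

open Classical in
/-- `M`-truncated multiple zeta-star value `ζ^{⋆,M}(s_0,…,s_{d-1})`. -/
noncomputable def zetaStarT (M d : ℕ) (s : ℕ → ℂ) : ℂ :=
  ∑ f ∈ Finset.univ.filter (fun f : Fin d → Fin M => ∀ i j : Fin d, i ≤ j → f i ≤ f j),
    ∏ i : Fin d, (((f i : ℕ) + 1 : ℕ) : ℂ) ^ (-(s i))

open Classical in
/-- `M`-truncated multiple zeta value `ζ^{M}(s_0,…,s_{d-1})`. -/
noncomputable def zetaMT (M d : ℕ) (s : ℕ → ℂ) : ℂ :=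
  ∑ f ∈ Finset.univ.filter (fun f : Fin d → Fin M => ∀ i j : Fin d, i < j → f i < f j),
    ∏ i : Fin d, (((f i : ℕ) + 1 : ℕ) : ℂ) ^ (-(s i))

/-- The Riemann zeta value `ζ(k) = Σ_{n ≥ 1} n^{-k}`. -/
noncomputable def zetaVal (k : ℕ) : ℂ := ∑' n : ℕ, ((n + 1 : ℕ) : ℂ) ^ (-(k : ℤ))

/-- `ζ^⋆(1,k) = Σ_{1 ≤ m ≤ n} m^{-1} n^{-k}`. -/
noncomputable def zetaStarOne (k : ℕ) : ℂ :=
  ∑' n : ℕ, (∑ m ∈ Finset.Icc 1 (n + 1), ((m : ℂ))⁻¹) * ((n + 1 : ℕ) : ℂ) ^ (-(k : ℤ))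


structure Frob (r : ℕ) (lam : ℕ → ℕ) (p : ℕ) (α β : Fin p → ℕ) : Prop where
  anti : ∀ i, lam (i + 1) ≤ lam i
  len : ∀ i, r ≤ i → lam i = 0
  ha : ∀ i : Fin p, lam (i : ℕ) = α i + (i : ℕ) + 1
  hb : ∀ i : Fin p, conjF lam r (i : ℕ) = β i + (i : ℕ) + 1
  hp : lam p ≤ p

lemma conjF_gt {r : ℕ} {lam : ℕ → ℕ} (h : Antitone lam) {i j : ℕ} (hi : i < r)
    (hj : j + 1 ≤ lam i) : i + 1 ≤ conjF lam r j := by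
  unfold conjF
  calc i + 1 = (Finset.range (i+1)).card := by simp
    _ ≤ _ := by
      apply Finset.card_le_card
      intro k hk
      simp only [Finset.mem_range, Finset.mem_filter] at hk ⊢
      exact ⟨by omega, hj.trans (h (by omega))⟩

lemma conjF_le {r : ℕ} {lam : ℕ → ℕ} (h : Antitone lam) {i j : ℕ}
    (hj : lam i ≤ j) : conjF lam r j ≤ i := by
  unfold conjF
  calc _ ≤ (Finset.range i).card := by
        apply Finset.card_le_card
        intro k hk
        simp only [Finset.mem_range, Finset.mem_filter] at hk ⊢
        by_contra hik
        have := h (show i ≤ k by omega)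
        omega
    _ = i := by simp

lemma conjF_le_r {r : ℕ} {lam : ℕ → ℕ} (j : ℕ) : conjF lam r j ≤ r := by
  unfold conjF
  exact (Finset.card_filter_le _ _).trans (by simp)

lemma conjF_anti {r : ℕ} {lam : ℕ → ℕ} {i j : ℕ} (h : i ≤ j) : conjF lam r j ≤ conjF lam r i := by
  unfold conjF
  apply Finset.card_le_card
  intro k hk
  simp only [Finset.mem_range, Finset.mem_filter] at hk ⊢
  omega

lemma Frob.sort {r : ℕ} {lam : ℕ → ℕ} {p : ℕ} {α β : Fin p → ℕ} (F : Frob r lam p α β) :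
    ∃ (f : Fin p → Fin r) (c : Fin r → ℕ) (σ : Equiv.Perm (Fin r)),
      (∀ j, (f j : ℕ) = r - 1 - β j) ∧ (∀ j, β j < r) ∧ Function.Injective f ∧
      (∀ j, c (f j) = r + α j) ∧ (∀ k, k ∉ Set.range f → c k = k) ∧
      (∀ k, c k = maya lam r (σ k)) ∧ Equiv.Perm.sign σ = ∏ j, (-1 : ℤˣ) ^ β j := by
  classical
  have anti : Antitone lam := antitone_nat_of_succ_le F.anti
  have hbr : ∀ j, β j < r := fun j => by
    have := F.hb j
    have := conjF_le_r (r := r) (lam := lam) (j : ℕ)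
    omega
  have bmono : ∀ i j : Fin p, i < j → β j < β i := fun i j h => by
    have h1 := F.hb i
    have h2 := F.hb j
    have h3 := conjF_anti (r := r) (lam := lam) (show (i : ℕ) ≤ j from h.le)
    have : (i : ℕ) < j := h
    omega
  have amono : ∀ i j : Fin p, i < j → α j < α i := fun i j h => by
    have h1 := F.ha i
    have h2 := F.ha j
    have h3 := anti (show (i : ℕ) ≤ j from h.le)
    have : (i : ℕ) < j := h
    omega
  have binj : ∀ i j : Fin p, β i = β j → i = j := fun i j h => by
    rcases lt_trichotomy i j with h1 | h1 | h1
    · have := bmono _ _ h1; omega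
    · exact h1
    · have := bmono _ _ h1; omega
  have hpr : ∀ j : Fin p, (j : ℕ) < r := fun j => by
    by_contra h
    have := F.len j (by omega)
    have := F.ha j
    omega
  let f : Fin p → Fin r := fun j => ⟨r - 1 - β j, by have := hbr j; omega⟩
  have hf : ∀ j, (f j : ℕ) = r - 1 - β j := fun j => rfl
  have finj : Function.Injective f := fun i j h => by
    apply binj
    have h1 : (f i : ℕ) = f j := by rw [h]
    rw [hf, hf] at h1
    have := hbr i; have := hbr j; omega
  let c : Fin r → ℕ := fun k => if h : ∃ j, f j = k then r + α h.choose else k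
  have hc1 : ∀ j, c (f j) = r + α j := fun j => by
    have h : ∃ j', f j' = f j := ⟨j, rfl⟩
    have h2 : h.choose = j := finj h.choose_spec
    simp only [c, dif_pos h, h2]
  have hc2 : ∀ k, k ∉ Set.range f → c k = k := fun k hk => by
    have h : ¬ ∃ j, f j = k := hk
    simp only [c, dif_neg h]
  have hmaya : StrictMono (maya lam r) := fun a b hab => by
    have h1 : (a : ℕ) < b := hab
    have := anti (show r - 1 - (b : ℕ) ≤ r - 1 - a by omega)
    unfold maya
    omega
  have hex : ∀ a : Fin r, ∃ k : Fin r, c k = maya lam r a := fun a => by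
    by_cases hp : r - 1 - (a : ℕ) < p
    · refine ⟨f ⟨_, hp⟩, ?_⟩
      rw [hc1]
      have := F.ha ⟨_, hp⟩
      simp only at this
      unfold maya
      have := a.2
      omega
    · have h1 := anti (show p ≤ r - 1 - (a : ℕ) by omega)
      have h2 := F.hp
      have h3 : maya lam r a < r := by
        unfold maya
        have := a.2
        omega
      refine ⟨⟨_, h3⟩, ?_⟩
      rw [hc2]
      rintro ⟨j, hj⟩
      have h4 : (f j : ℕ) = maya lam r a := by rw [hj]
      rw [hf] at h4
      have h5 := F.hb j
      have h6 := hbr j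
      have h7 := a.2
      unfold maya at h4
      rcases Nat.lt_or_ge (j : ℕ) (lam (r - 1 - (a : ℕ))) with h | h
      · have := conjF_gt (r := r) anti (show r - 1 - (a : ℕ) < r by omega) h
        omega
      · have := conjF_le (r := r) anti h
        omega
  choose τ hτ using hex
  have τinj : Function.Injective τ := fun a b h => by
    apply hmaya.injective
    rw [← hτ, ← hτ, h]
  let e : Equiv.Perm (Fin r) := Equiv.ofBijective τ (Finite.injective_iff_bijective.mp τinj)
  have hσ : ∀ k, c k = maya lam r (e.symm k) := fun k => by
    rw [← hτ]
    congr 1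
    exact (e.apply_symm_apply k).symm
  refine ⟨f, c, e.symm, hf, hbr, finj, hc1, hc2, hσ, ?_⟩
  have hlt : ∀ a b, e.symm a < e.symm b ↔ c a < c b := fun a b => by
    rw [hσ, hσ, hmaya.lt_iff_lt]
  rw [Equiv.Perm.sign_eq_prod_prod_Ioi]
  symm
  apply Fintype.prod_of_injective f finj
  · intro k hk
    apply Finset.prod_eq_one
    intro b hb
    rw [Finset.mem_Ioi] at hb
    have hb' : (k : ℕ) < b := hb
    rw [if_pos]
    rw [hlt, hc2 k hk]
    by_cases hbr' : b ∈ Set.range f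
    · obtain ⟨j, rfl⟩ := hbr'
      rw [hc1]
      have := k.2
      omega
    · rw [hc2 b hbr']; exact hb'
  · intro j
    rw [Finset.prod_congr rfl (g := fun _ => (-1 : ℤˣ))]
    · rw [Finset.prod_const, Fin.card_Ioi, hf]
      congr 1
      have := hbr j
      omega
    · intro b hb
      rw [Finset.mem_Ioi] at hb
      have hb' : (f j : ℕ) < b := hb
      rw [if_neg]
      rw [hlt, hc1]
      by_cases hbr' : b ∈ Set.range f
      · obtain ⟨i, rfl⟩ := hbr'
        rw [hc1]
        rw [hf, hf] at hb'
        have hij : j < i := by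
          rcases lt_trichotomy i j with h1 | h1 | h1
          · have := bmono _ _ h1; have := hbr i; have := hbr j; omega
          · subst h1; omega
          · exact h1
        have := amono _ _ hij
        omega
      · rw [hc2 b hbr']
        have := b.2
        omega

lemma core_det {R : Type*} [CommRing R] {r p q : ℕ} (A W : Matrix (Fin r) (Fin r) R)
    (hA : A.det = 1) (B : Matrix (Fin r) (Fin p) R) (D : Matrix (Fin q) (Fin p) R)
    (f : Fin p → Fin r) (g : Fin q → Fin r) (hf : Function.Injective f)
    (hg : Function.Injective g)
    (h00 : ∀ i j, i ∉ Set.range g → j ∉ Set.range f → W i j = A i j)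
    (h01 : ∀ i j, i ∉ Set.range g → W i (f j) = B i j)
    (h10 : ∀ i j, j ∉ Set.range f → W (g i) j = 0)
    (h11 : ∀ i j, W (g i) (f j) = D i j) :
    W.det = (Matrix.fromBlocks (Matrix.of fun i j => (A⁻¹ * B) (f i) j)
      (Matrix.of fun i j => A⁻¹ (f i) (g j)) (-D) 0).det := by
  classical
  have hu : IsUnit A.det := by rw [hA]; exact isUnit_one
  let F : Matrix (Fin p) (Fin r) R := (1 : Matrix (Fin r) (Fin r) R).submatrix f id
  let F' : Matrix (Fin r) (Fin p) R := (1 : Matrix (Fin r) (Fin r) R).submatrix id f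
  let G : Matrix (Fin q) (Fin r) R := (1 : Matrix (Fin r) (Fin r) R).submatrix g id
  let G' : Matrix (Fin r) (Fin q) R := (1 : Matrix (Fin r) (Fin r) R).submatrix id g
  have FX : ∀ {n : ℕ} (X : Matrix (Fin r) (Fin n) R), F * X = X.submatrix f id := by
    intro n X
    ext i j; simp [F, Matrix.mul_apply, Matrix.one_apply]
  have GX : ∀ {n : ℕ} (X : Matrix (Fin r) (Fin n) R), G * X = X.submatrix g id := by
    intro n X
    ext i j; simp [G, Matrix.mul_apply, Matrix.one_apply]
  have XF : ∀ {n : ℕ} (X : Matrix (Fin n) (Fin r) R), X * F' = X.submatrix id f := by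
    intro n X
    ext i j; simp [F', Matrix.mul_apply, Matrix.one_apply]
  have XG : ∀ {n : ℕ} (X : Matrix (Fin n) (Fin r) R), X * G' = X.submatrix id g := by
    intro n X
    ext i j; simp [G', Matrix.mul_apply, Matrix.one_apply]
  have FF : F * F' = 1 := by
    rw [FX]; ext i j; simp [F', Matrix.one_apply, hf.eq_iff]
  have GG : G * G' = 1 := by
    rw [GX]; ext i j; simp [G', Matrix.one_apply, hg.eq_iff]
  have XF1 : ∀ {n : ℕ} (X : Matrix (Fin n) (Fin p) R) i j, (X * F) i (f j) = X i j := by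
    intro n X i j
    simp [F, Matrix.mul_apply, Matrix.one_apply, hf.eq_iff]
  have XF0 : ∀ {n : ℕ} (X : Matrix (Fin n) (Fin p) R) i j, j ∉ Set.range f → (X * F) i j = 0 := by
    intro n X i j hj
    have : ∀ k, f k ≠ j := fun k h => hj ⟨k, h⟩
    simp [F, Matrix.mul_apply, this]
  have GX1 : ∀ {n : ℕ} (X : Matrix (Fin q) (Fin n) R) i j, (G' * X) (g i) j = X i j := by
    intro n X i j
    simp [G', Matrix.mul_apply, Matrix.one_apply, hg.eq_iff]
  have GX0 : ∀ {n : ℕ} (X : Matrix (Fin q) (Fin n) R) i j, i ∉ Set.range g → (G' * X) i j = 0 := by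
    intro n X i j hj
    have : ∀ k, i ≠ g k := fun k h => hj ⟨k, h.symm⟩
    simp [G', Matrix.mul_apply, this]
  let K : Matrix (Fin r) (Fin p) R := (B - A * F') - G' * (G * (B - A * F')) + G' * D
  have hW : W = A - G' * (G * A) + K * F := by
    ext i j
    rw [Matrix.add_apply, Matrix.sub_apply]
    by_cases hi : i ∈ Set.range g
    · obtain ⟨i, rfl⟩ := hi
      rw [GX1, GX]
      by_cases hj : j ∈ Set.range f
      · obtain ⟨j, rfl⟩ := hj
        rw [XF1, h11]
        simp only [K, Matrix.add_apply, Matrix.sub_apply, GX1, GX]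
        simp
      · rw [XF0 _ _ _ hj, h10 _ _ hj]; simp
    · rw [GX0 _ _ _ hi]
      by_cases hj : j ∈ Set.range f
      · obtain ⟨j, rfl⟩ := hj
        rw [XF1, h01 _ _ hi]
        simp only [K, Matrix.add_apply, Matrix.sub_apply, GX0 _ _ _ hi, XF]
        simp
      · rw [XF0 _ _ _ hj, h00 _ _ hi hj]; simp
  have hAA : A * A⁻¹ = 1 := Matrix.mul_nonsing_inv A hu
  have hAA' : A⁻¹ * A = 1 := Matrix.nonsing_inv_mul A hu
  have hW2 : W = A * (1 + (A⁻¹ * Matrix.fromCols K G') * (Matrix.fromRows F (-(G * A)))) := by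
    rw [Matrix.mul_add, Matrix.mul_one, Matrix.mul_assoc, ← Matrix.mul_assoc A, hAA, Matrix.one_mul,
      Matrix.fromCols_mul_fromRows, hW]
    simp only [Matrix.mul_neg]
    abel
  have GK : G * K = D := by
    simp only [K, Matrix.mul_add, Matrix.mul_sub, ← Matrix.mul_assoc, GG, Matrix.one_mul]
    abel
  let Z : Matrix (Fin q) (Fin p) R := D - G * (B - A * F')
  have FK : 1 + F * A⁻¹ * K = F * A⁻¹ * B + F * A⁻¹ * G' * Z := by
    have e1 : F * A⁻¹ * (A * F') = 1 := by
      rw [Matrix.mul_assoc, ← Matrix.mul_assoc A⁻¹, hAA', Matrix.one_mul, FF]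
    simp only [K, Z]
    rw [Matrix.mul_add, Matrix.mul_sub _ _ (G' * _), Matrix.mul_sub _ B, e1, Matrix.mul_sub _ D,
      ← Matrix.mul_assoc _ G', ← Matrix.mul_assoc _ G']
    abel
  rw [hW2, Matrix.det_mul, hA, one_mul, Matrix.det_one_add_mul_comm, ← Matrix.mul_assoc,
    Matrix.fromRows_mul, Matrix.fromRows_mul_fromCols]
  have e2 : (1 : Matrix (Fin p ⊕ Fin q) (Fin p ⊕ Fin q) R) + Matrix.fromBlocks (F * A⁻¹ * K)
        (F * A⁻¹ * G') (-(G * A) * A⁻¹ * K) (-(G * A) * A⁻¹ * G') =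
      Matrix.fromBlocks (F * A⁻¹ * B) (F * A⁻¹ * G') (-D) 0 * Matrix.fromBlocks 1 0 Z 1 := by
    rw [← Matrix.fromBlocks_one, Matrix.fromBlocks_add, Matrix.fromBlocks_multiply]
    have e3 : -(G * A) * A⁻¹ = -G := by
      rw [Matrix.neg_mul, Matrix.mul_assoc, hAA, Matrix.mul_one]
    rw [FK, e3, Matrix.neg_mul, Matrix.neg_mul, GK, GG]
    simp
  rw [e2, Matrix.det_mul, Matrix.det_fromBlocks_zero₁₂]
  simp only [Matrix.det_one, mul_one]
  congr 2
  · rw [Matrix.mul_assoc, FX]; rfl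
  · rw [XG, FX]; rfl

lemma matExt_diag {R : Type*} [CommRing R] {N : ℕ} {U : Matrix (Fin N) (Fin N) R}
    (hU : UpperUni U) {i : ℕ} (hi : i < N) : matExt U i i = 1 := by
  unfold matExt
  rw [dif_pos hi, dif_pos hi]
  exact hU.1 _

lemma matExt_low {R : Type*} [CommRing R] {N : ℕ} {U : Matrix (Fin N) (Fin N) R}
    (hU : UpperUni U) {i j : ℕ} (hij : j < i) : matExt U i j = 0 := by
  unfold matExt
  split_ifs with h1 h2
  · exact hU.2 _ _ hij
  · rfl
  · rfl

/-- leading principal block -/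
def leadA {R : Type*} [CommRing R] {N : ℕ} (U : Matrix (Fin N) (Fin N) R) (r : ℕ) :
    Matrix (Fin r) (Fin r) R := Matrix.of fun i j => matExt U i j

lemma leadA_det {R : Type*} [CommRing R] {N : ℕ} {U : Matrix (Fin N) (Fin N) R}
    (hU : UpperUni U) {r : ℕ} (hr : r ≤ N) : (leadA U r).det = 1 := by
  rw [Matrix.det_of_isUpperTriangular]
  · apply Finset.prod_eq_one
    intro i _
    exact matExt_diag hU (by omega)
  · intro i j hij
    exact matExt_low hU hij

lemma key {R : Type*} [CommRing R] {N : ℕ} {U : Matrix (Fin N) (Fin N) R}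
    (hU : UpperUni U) {r : ℕ} (hr : r ≤ N) {lam mu : ℕ → ℕ} {p q : ℕ} {α β : Fin p → ℕ}
    {γ δ : Fin q → ℕ} (Fl : Frob r lam p α β) (Fm : Frob r mu q γ δ) :
    ∃ (f : Fin p → Fin r) (g : Fin q → Fin r),
      (∀ j, (f j : ℕ) = r - 1 - β j) ∧ (∀ j, β j < r) ∧
      (∀ j, (g j : ℕ) = r - 1 - δ j) ∧ (∀ j, δ j < r) ∧
      SchurV U r lam mu = (∏ j, (-1 : R) ^ β j) * (∏ j, (-1 : R) ^ δ j) *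
        (Matrix.fromBlocks
          (Matrix.of fun i j => ((leadA U r)⁻¹ *
            (Matrix.of fun (i : Fin r) (j : Fin p) => matExt U i (r + α j))) (f i) j)
          (Matrix.of fun i j => (leadA U r)⁻¹ (f i) (g j))
          (-(Matrix.of fun (i : Fin q) (j : Fin p) => matExt U (r + γ i) (r + α j))) 0).det := by
  obtain ⟨f, c, σ, hf, hb, finj, c1, c2, hc, hs⟩ := Fl.sort
  obtain ⟨g, c', σ', hg, hd, ginj, c1', c2', hc', hs'⟩ := Fm.sort
  refine ⟨f, g, hf, hb, hg, hd, ?_⟩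
  rw [← core_det (leadA U r) (Matrix.of fun i j => matExt U (c' i) (c j)) (leadA_det hU hr)
    _ _ f g finj ginj]
  · have e1 : (Matrix.of fun i j => matExt U (c' i) (c j)) =
        ((Matrix.of fun i j : Fin r => matExt U (maya mu r i) (maya lam r j)).submatrix
          σ' id).submatrix id σ := by
      ext i j
      simp [hc, hc']
    rw [e1, Matrix.det_permute', Matrix.det_permute, hs, hs']
    have sq : ∀ {n : ℕ} (b : Fin n → ℕ), (∏ j, (-1 : R) ^ b j) * (∏ j, (-1 : R) ^ b j) = 1 := by
      intro n b
      rw [← Finset.prod_mul_distrib]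
      apply Finset.prod_eq_one
      intro i _
      rw [← mul_pow]; simp
    push_cast
    rw [show ∀ a b d : R, a * b * (a * (b * d)) = (a * a) * (b * b) * d by intros; ring, sq, sq]
    simp [SchurV]
  · intro i j hi hj
    simp [c2 _ hj, c2' _ hi, leadA]
  · intro i j hi
    simp [c2' _ hi, c1]
  · intro i j hj
    simp only [Matrix.of_apply, c1', c2 _ hj]
    exact matExt_low hU (by omega)
  · intro i j
    simp [c1, c1']

lemma frob_zero (r : ℕ) (a b : Fin 0 → ℕ) : Frob r (fun _ => 0) 0 a b where
  anti := by simp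
  len := by simp
  ha := fun i => i.elim0
  hb := fun i => i.elim0
  hp := le_rfl

lemma frob_hook (r a b : ℕ) (hb : b < r) :
    Frob r (hookP a b) 1 (fun _ => a) (fun _ => b) where
  anti := by
    intro i
    simp only [hookP]
    rw [if_neg (Nat.succ_ne_zero i)]
    split_ifs <;> omega
  len := by
    intro i hi
    unfold hookP
    split_ifs <;> omega
  ha := by intro i; simp [hookP]
  hb := by
    intro i
    have : ((Finset.range r).filter fun j => (i : ℕ) + 1 ≤ hookP a b j) = Finset.range (b + 1) := by
      ext k
      rw [Finset.mem_filter, Finset.mem_range, Finset.mem_range]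
      have hi := i.2
      simp only [hookP]
      split_ifs <;> omega
    unfold conjF
    rw [this]; simp
  hp := by
    simp only [hookP]
    rw [if_neg one_ne_zero]
    split_ifs <;> omega

lemma hook_eq {R : Type*} [CommRing R] {N : ℕ} {U : Matrix (Fin N) (Fin N) R}
    (hU : UpperUni U) {r : ℕ} (hr : r ≤ N) (a b : ℕ) (i : Fin r) (hb : b < r)
    (hi : (i : ℕ) = r - 1 - b) :
    ∑ k, (leadA U r)⁻¹ i k * matExt U k (r + a) =
      (-1) ^ b * SchurV U r (hookP a b) (fun _ => 0) := by
  obtain ⟨f, g, hf, _, hg, _, h⟩ :=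
    key hU hr (frob_hook r a b hb) (frob_zero r (fun _ => 0) (fun _ => 0))
  rw [h]
  have : f 0 = i := by ext; rw [hf, hi]
  rw [← Matrix.det_submatrix_equiv_self (Equiv.sumEmpty (Fin 1) (Fin 0)).symm, Matrix.det_fin_one]
  simp only [Matrix.submatrix_apply, Equiv.sumEmpty_symm_apply, Matrix.fromBlocks_apply₁₁,
    Matrix.of_apply, this, Matrix.mul_apply]
  simp only [Finset.univ_unique, Finset.prod_singleton, Finset.univ_eq_empty, Finset.prod_empty,
    mul_one]
  rw [← mul_assoc, ← mul_pow]
  simp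

lemma h_eq {R : Type*} [CommRing R] {N : ℕ} {U : Matrix (Fin N) (Fin N) R}
    (hU : UpperUni U) (r a c : ℕ) (h : r + c + 1 ≤ N) :
    hSV U (r + c + 1) ((a : ℤ) - (c : ℤ)) = matExt U (r + c) (r + a) := by
  unfold hSV
  split_ifs with hac
  · unfold SchurV
    rw [Matrix.det_of_isUpperTriangular]
    · rw [Fin.prod_univ_castSucc, Finset.prod_eq_one, one_mul]
      · simp only [Matrix.of_apply, maya, Fin.val_last]
        congr 1
        · omega
        · rw [if_pos (by omega)]; omega
      · intro i _
        have := i.2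
        simp only [Matrix.of_apply, maya, Fin.val_castSucc]
        rw [if_neg (by omega)]
        apply matExt_diag hU
        omega
    · intro i j hij
      have hij' : (j : ℕ) < i := hij
      have := i.2
      simp only [Matrix.of_apply, maya]
      apply matExt_low hU
      rw [if_neg (by omega)]
      omega
  · rw [matExt_low hU]; omega

lemma e_eq {R : Type*} [CommRing R] {N : ℕ} {U : Matrix (Fin N) (Fin N) R}
    (hU : UpperUni U) {r : ℕ} (hr : r ≤ N) (b d : ℕ) (i k : Fin r) (hb : b < r) (hd : d < r)
    (hi : (i : ℕ) = r - 1 - b) (hk : (k : ℕ) = r - 1 - d) :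
    (leadA U r)⁻¹ i k = (-1) ^ b * (-1) ^ d * eSV U (r - d - 1) ((b : ℤ) - (d : ℤ)) := by
  have hks : r - d - 1 = (k : ℕ) := by omega
  rw [hks]
  have hkr := k.2
  have hu : IsUnit (leadA U r).det := by rw [leadA_det hU hr]; exact isUnit_one
  have huk : IsUnit (leadA U k).det := by
    rw [leadA_det hU (by omega)]; exact isUnit_one
  let x : Fin (k : ℕ) → R := (leadA U k)⁻¹ *ᵥ (fun j : Fin (k : ℕ) => matExt U j k)
  have hx : leadA U k *ᵥ x = fun j : Fin (k : ℕ) => matExt U j k := by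
    simp only [x]
    rw [Matrix.mulVec_mulVec, Matrix.mul_nonsing_inv _ huk, Matrix.one_mulVec]
  let v : ℕ → R := fun j => if h : j < k then - x ⟨j, h⟩ else if j = k then 1 else 0
  have hv : leadA U r *ᵥ (fun j : Fin r => v j) = Pi.single k 1 := by
    ext m
    simp only [Matrix.mulVec, dotProduct, leadA, Matrix.of_apply]
    rw [Fin.sum_univ_eq_sum_range (fun j => matExt U m j * v j) r]
    rw [← Finset.sum_subset (s₁ := Finset.range (k + 1))
      (by intro j; simp only [Finset.mem_range]; omega)
      (by
        intro j _ hj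
        simp only [Finset.mem_range] at hj
        simp only [v]
        rw [dif_neg (by omega), if_neg (by omega), mul_zero])]
    rw [Finset.sum_range_succ]
    have e1 : v k = 1 := by simp [v]
    rw [e1, mul_one, ← Fin.sum_univ_eq_sum_range (fun j => matExt U m j * v j) k]
    have e2 : ∀ j : Fin (k : ℕ), v j = - x j := fun j => by simp [v]
    simp only [e2]
    by_cases hm : (m : ℕ) < k
    · have := congrFun hx ⟨m, hm⟩
      simp only [Matrix.mulVec, dotProduct, leadA, Matrix.of_apply] at this
      simp only [mul_neg, Finset.sum_neg_distrib, this]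
      rw [Pi.single_eq_of_ne (by intro h; rw [h] at hm; omega)]
      simp
    · rw [Finset.sum_eq_zero, zero_add]
      · by_cases hmk : m = k
        · subst hmk
          rw [Pi.single_eq_same, matExt_diag hU (by omega)]
        · rw [Pi.single_eq_of_ne hmk]
          apply matExt_low hU
          have : (m : ℕ) ≠ k := fun h => hmk (Fin.ext h)
          omega
      · intro j _
        rw [matExt_low hU (by omega), zero_mul]
  have hv2 : (leadA U r)⁻¹ i k = v i := by
    have h3 : (leadA U r)⁻¹ *ᵥ (leadA U r *ᵥ (fun j : Fin r => v j)) = fun j : Fin r => v j := by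
      rw [Matrix.mulVec_mulVec, Matrix.nonsing_inv_mul _ hu, Matrix.one_mulVec]
    rw [hv] at h3
    have := congrFun h3 i
    simpa using this
  rw [hv2]
  unfold eSV
  rcases lt_trichotomy b d with h | h | h
  · rw [if_neg (by omega), mul_zero]
    simp only [v]
    rw [dif_neg (by omega), if_neg (by omega)]
  · subst h
    rw [if_pos (by omega), ← mul_pow]
    simp only [v]
    rw [dif_neg (by omega), if_pos (by omega)]
    have hz : (fun j => if j < ((b : ℤ) - (b : ℤ)).toNat then 1 else 0) = fun _ : ℕ => 0 := by
      ext j; simp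
    rw [hz]
    have : SchurV U (k : ℕ) (fun _ => 0) (fun _ => 0) = 1 := by
      rw [← leadA_det hU (show (k : ℕ) ≤ N by omega)]
      simp [SchurV, maya, leadA]
    rw [this]; simp
  · obtain ⟨e, rfl⟩ : ∃ e, b = d + e + 1 := ⟨b - d - 1, by omega⟩
    rw [if_pos (by omega)]
    have hz : (fun j => if j < (((d + e + 1 : ℕ) : ℤ) - (d : ℤ)).toNat then 1 else 0)
        = hookP 0 e := by
      ext j
      unfold hookP
      split_ifs <;> omega
    rw [hz]
    have hik : (i : ℕ) < k := by omega
    have h5 := hook_eq hU (show (k : ℕ) ≤ N by omega) 0 e ⟨i, hik⟩ (by omega)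
      (by simp only; omega)
    have h6 : v i = - x ⟨i, hik⟩ := by simp only [v]; rw [dif_pos hik]
    have h7 : x ⟨i, hik⟩ = (-1) ^ e * SchurV U k (hookP 0 e) (fun _ => 0) := by
      rw [← h5]
      simp [x, Matrix.mulVec, dotProduct]
    rw [h6, h7]
    have h8 : (-1 : R) ^ d * (-1) ^ d = 1 := by rw [← mul_pow]; simp
    rw [pow_add, pow_add]
    linear_combination (-(SchurV U k (hookP 0 e) (fun _ => 0)) * (-1) ^ e) * (-h8)
/-- Giambelli formula for the ninth variation of skew Schur functions. -/
theorem giambelli_ninth_variation {R : Type*} [CommRing R] {N : ℕ} (hN : 0 < N)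
    (U : Matrix (Fin N) (Fin N) R) (hU : UpperUni U)
    (r : ℕ) (hrN : r ≤ N)
    (lam mu : ℕ → ℕ)
    (hlam : ∀ i, lam (i + 1) ≤ lam i) (hmu : ∀ i, mu (i + 1) ≤ mu i)
    (hsub : ∀ i, mu i ≤ lam i)
    (hlen : ∀ i, r ≤ i → lam i = 0) (hwid : lam 0 ≤ N - r)
    (p q : ℕ) (α β : Fin p → ℕ) (γ δ : Fin q → ℕ)
    (hα : ∀ i : Fin p, lam (i : ℕ) = α i + (i : ℕ) + 1)
    (hβ : ∀ i : Fin p, conjF lam r (i : ℕ) = β i + (i : ℕ) + 1)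
    (hp : lam p ≤ p)
    (hγ : ∀ i : Fin q, mu (i : ℕ) = γ i + (i : ℕ) + 1)
    (hδ : ∀ i : Fin q, conjF mu r (i : ℕ) = δ i + (i : ℕ) + 1)
    (hq : mu q ≤ q) :
    SchurV U r lam mu =
      (-1 : R) ^ q *
        Matrix.det
          (Matrix.fromBlocks
            (Matrix.of fun i j : Fin p => SchurV U r (hookP (α i) (β j)) (fun _ => 0))
            (Matrix.of fun (i : Fin p) (j : Fin q) =>
              hSV U (r + γ j + 1) ((α i : ℤ) - (γ j : ℤ)))
            (Matrix.of fun (i : Fin q) (j : Fin p) =>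
              eSV U (r - δ i - 1) ((β j : ℤ) - (δ i : ℤ)))
            (0 : Matrix (Fin q) (Fin q) R)) := by

  have mule : ∀ i, r ≤ i → mu i = 0 := fun i hi => by
    have := hsub i
    have := hlen i hi
    omega
  obtain ⟨f, g, hf, hb, hg, hd, h⟩ := key hU hrN (Frob.mk hlam hlen hα hβ hp)
    (Frob.mk hmu mule hγ hδ hq)
  rw [h]
  have hgN : ∀ j, r + γ j + 1 ≤ N := fun j => by
    have h1 := hγ j
    have h2 : mu (j : ℕ) ≤ mu 0 := antitone_nat_of_succ_le hmu (Nat.zero_le _)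
    have h3 := hsub 0
    omega
  set G := (Matrix.fromBlocks
            (Matrix.of fun i j : Fin p => SchurV U r (hookP (α i) (β j)) (fun _ => 0))
            (Matrix.of fun (i : Fin p) (j : Fin q) =>
              hSV U (r + γ j + 1) ((α i : ℤ) - (γ j : ℤ)))
            (Matrix.of fun (i : Fin q) (j : Fin p) =>
              eSV U (r - δ i - 1) ((β j : ℤ) - (δ i : ℤ)))
            (0 : Matrix (Fin q) (Fin q) R)) with hG
  have e1 : (Matrix.fromBlocks
          (Matrix.of fun i j => ((leadA U r)⁻¹ *
            (Matrix.of fun (i : Fin r) (j : Fin p) => matExt U i (r + α j))) (f i) j)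
          (Matrix.of fun i j => (leadA U r)⁻¹ (f i) (g j))
          (-(Matrix.of fun (i : Fin q) (j : Fin p) => matExt U (r + γ i) (r + α j)))
          (0 : Matrix (Fin q) (Fin q) R)) =
      Matrix.diagonal (Sum.elim (fun i => (-1 : R) ^ β i) (fun _ => -1)) * Gᵀ *
        Matrix.diagonal (Sum.elim (fun _ => (1 : R)) (fun j => (-1) ^ δ j)) := by
    ext i j
    rw [Matrix.mul_diagonal, Matrix.diagonal_mul, Matrix.transpose_apply, hG]
    rcases i with i | i <;> rcases j with j | j
    · simp only [Matrix.fromBlocks_apply₁₁, Matrix.of_apply, Sum.elim_inl, mul_one,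
        Matrix.mul_apply]
      exact hook_eq hU hrN (α j) (β i) (f i) (hb i) (hf i)
    · simp only [Matrix.fromBlocks_apply₁₂, Matrix.fromBlocks_apply₂₁, Matrix.of_apply,
        Sum.elim_inl, Sum.elim_inr]
      rw [e_eq hU hrN (β i) (δ j) (f i) (g j) (hb i) (hd j) (hf i) (hg j)]
      ring
    · simp only [Matrix.fromBlocks_apply₁₂, Matrix.fromBlocks_apply₂₁, Matrix.of_apply,
        Sum.elim_inl, Sum.elim_inr, Matrix.neg_apply]
      rw [h_eq hU r (α j) (γ i) (hgN i)]
      ring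
    · simp
  rw [e1, Matrix.det_mul, Matrix.det_mul, Matrix.det_transpose, Matrix.det_diagonal,
    Matrix.det_diagonal]
  have sq : ∀ {n : ℕ} (b : Fin n → ℕ), (∏ j, (-1 : R) ^ b j) * (∏ j, (-1 : R) ^ b j) = 1 := by
    intro n b
    rw [← Finset.prod_mul_distrib]
    apply Finset.prod_eq_one
    intro i _
    rw [← mul_pow]; simp
  simp only [Fintype.prod_sum_type, Sum.elim_inl, Sum.elim_inr, Finset.prod_const_one, one_mul,
    Finset.prod_const, Finset.card_univ, Fintype.card_fin]
  rw [show ∀ a b c d : R, a * b * (a * c * d * b) = (a * a) * (b * b) * (c * d) by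
    intros; ring, sq, sq]
  ring
end

section
/- Desnanot–Jacobi quadratic relation, e-version (Theorem 3.2(2)): Let R be a commutative ring, N a positive integer, U an N×N upper unitriangular matrix over R, and l ≥ 1, r integers. Let λ ⊇ μ be partitions whose conjugates are λ' = (λ'_1,…,λ'_{l+1}) and μ' = (μ'_1,…,μ'_{l+1}) (padded with zeros to length l+1), and assume λ'_1 + 1 ≤ r and λ_1 + 2 ≤ N − r. Then S^{(r)}_{(λ'_1,…,λ'_{l+1})'/(μ'_1,…,μ'_{l+1})'}(U) · S^{(r+1)}_{(λ'_2,…,λ'_l)'/(μ'_2,…,μ'_l)'}(U) = S^{(r)}_{(λ'_1,…,λ'_l)'/(μ'_1,…,μ'_l)'}(U) · S^{(r+1)}_{(λ'_2,…,λ'_{l+1})'/(μ'_2,…,μ'_{l+1})'}(U) − S^{(r)}_{(λ'_2−1,…,λ'_{l+1}−1)'/(μ'_1,…,μ'_l)'}(U) · S^{(r+1)}_{(λ'_1+1,…,λ'_l+1)'/(μ'_2,…,μ'_{l+1})'}(U), where ν' denotes the conjugate partition of ν and S^{(r')}_{ν/κ}(U) := 0 whenever ν/κ is not a skew partition (in particular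 when some entry is negative). -/
open Matrix BigOperators Finset Filter

theorem dj_det_two_cols {S : Type*} [CommRing S] {ι : Type*} [Fintype ι] [DecidableEq ι]
    (k m : ι) (hkm : k ≠ m) (u v : ι → S) :
    (((1 : Matrix ι ι S).updateCol k u).updateCol m v).det = u k * v m - v k * u m := by
  have h : (((1 : Matrix ι ι S).updateCol k u).updateCol m v) =
      1 + (Matrix.of fun (i : ι) (s : Fin 2) =>
          if s = 0 then u i - (1 : Matrix ι ι S) i k else v i - (1 : Matrix ι ι S) i m) *
        (Matrix.of fun (s : Fin 2) (j : ι) =>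
          if s = 0 then (1 : Matrix ι ι S) k j else (1 : Matrix ι ι S) m j) := by
    ext i j
    simp only [Matrix.updateCol_apply, Matrix.add_apply, Matrix.mul_apply, Matrix.of_apply,
      Fin.sum_univ_two, Matrix.one_apply]
    by_cases hj : j = m
    · subst hj
      simp [hkm]
    · by_cases hk : j = k
      · subst hk
        simp [hj, Ne.symm hkm]
      · simp [hj, hk, Ne.symm hj, Ne.symm hk]
  rw [h, Matrix.det_one_add_mul_comm, Matrix.det_fin_two]
  simp [Matrix.mul_apply, Matrix.one_apply, hkm, Ne.symm hkm]

theorem dj_expand_col {S : Type*} [CommRing S] {n : ℕ}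
    (M : Matrix (Fin (n + 1)) (Fin (n + 1)) S) (j m : Fin (n + 1)) :
    (M.updateCol m (Pi.single j 1)).det =
      (-1) ^ (j + m : ℕ) * (M.submatrix j.succAbove m.succAbove).det := by
  rw [Matrix.det_succ_column _ m, Fintype.sum_eq_single j]
  · simp [Matrix.submatrix_updateCol_succAbove]
  · intro i hi
    simp [hi]

theorem dj_expand_two {S : Type*} [CommRing S] {n : ℕ}
    (M : Matrix (Fin (n + 2)) (Fin (n + 2)) S) (j m : Fin (n + 2)) (i k : Fin (n + 1)) :
    ((M.updateCol (m.succAbove k) (Pi.single (j.succAbove i) 1)).updateCol m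
        (Pi.single j 1)).det =
      (-1) ^ (j + m : ℕ) * ((-1) ^ (i + k : ℕ) *
        (M.submatrix (fun a => j.succAbove (i.succAbove a))
          (fun a => m.succAbove (k.succAbove a))).det) := by
  rw [dj_expand_col]
  have : (M.updateCol (m.succAbove k) (Pi.single (j.succAbove i) 1)).submatrix
      j.succAbove m.succAbove =
      (M.submatrix j.succAbove m.succAbove).updateCol k (Pi.single i 1) := by
    ext a b
    simp [Matrix.updateCol_apply, Pi.single_apply]
  rw [this, dj_expand_col]
  rfl

theorem dj_regular {S : Type*} [CommRing S] [IsDomain S] {n : ℕ}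
    (M : Matrix (Fin (n + 2)) (Fin (n + 2)) S) (hM : M.det ≠ 0)
    (j m : Fin (n + 2)) (i k : Fin (n + 1)) (hij : (i : ℕ) < j) (hkm : (k : ℕ) < m) :
    M.det * (M.submatrix (fun a => j.succAbove (i.succAbove a))
          (fun a => m.succAbove (k.succAbove a))).det =
      (M.submatrix i.castSucc.succAbove k.castSucc.succAbove).det *
        (M.submatrix j.succAbove m.succAbove).det -
      (M.submatrix i.castSucc.succAbove m.succAbove).det *
        (M.submatrix j.succAbove k.castSucc.succAbove).det := by
  have hi : j.succAbove i = i.castSucc := Fin.succAbove_of_castSucc_lt _ _ (by simpa [Fin.lt_def] using hij)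
  have hk : m.succAbove k = k.castSucc := Fin.succAbove_of_castSucc_lt _ _ (by simpa [Fin.lt_def] using hkm)
  have hne : k.castSucc ≠ m := by
    intro h
    rw [← h] at hkm
    simp at hkm
  have key : (M * (((1 : Matrix _ _ S).updateCol k.castSucc (fun t => M.adjugate t i.castSucc)).updateCol m
      (fun t => M.adjugate t j))).det = M.det * (M.det * ((M.updateCol k.castSucc
        (Pi.single i.castSucc 1)).updateCol m (Pi.single j 1)).det) := by
    rw [Matrix.mul_updateCol, Matrix.mul_updateCol, Matrix.mul_one]
    have hc : ∀ t, M *ᵥ (fun s => M.adjugate s t) = M.det • (Pi.single t 1 : Fin (n+2) → S) := by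
      intro t
      ext s
      have := congrFun (congrFun (Matrix.mul_adjugate M) s) t
      rw [Matrix.mul_apply] at this
      simp only [Matrix.mulVec, dotProduct, this]
      simp [Matrix.one_apply, Pi.single_apply]
    rw [hc, hc, Matrix.det_updateCol_smul, Matrix.updateCol_comm _ hne, Matrix.det_updateCol_smul,
      Matrix.updateCol_comm _ hne.symm]
  rw [Matrix.det_mul, dj_det_two_cols _ _ hne, ← hi, ← hk, dj_expand_two, hi, hk] at key
  have key := mul_left_cancel₀ hM key
  simp only [Matrix.adjugate_fin_succ_eq_det_submatrix, Fin.val_castSucc] at key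
  have e1 : ((-1 : S) ^ (i : ℕ)) * (-1) ^ (i : ℕ) = 1 := by rw [← mul_pow]; simp
  have e2 : ((-1 : S) ^ (j : ℕ)) * (-1) ^ (j : ℕ) = 1 := by rw [← mul_pow]; simp
  have e3 : ((-1 : S) ^ (k : ℕ)) * (-1) ^ (k : ℕ) = 1 := by rw [← mul_pow]; simp
  have e4 : ((-1 : S) ^ (m : ℕ)) * (-1) ^ (m : ℕ) = 1 := by rw [← mul_pow]; simp
  simp only [pow_add] at key
  have hs : ((-1 : S) ^ (i : ℕ)) * (-1) ^ (j : ℕ) * (-1) ^ (k : ℕ) * (-1) ^ (m : ℕ) ≠ 0 := by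
    simp
  apply mul_left_cancel₀ hs
  linear_combination -key

theorem dj_general {S : Type*} [CommRing S] {n : ℕ}
    (M : Matrix (Fin (n + 2)) (Fin (n + 2)) S)
    (j m : Fin (n + 2)) (i k : Fin (n + 1)) (hij : (i : ℕ) < j) (hkm : (k : ℕ) < m) :
    M.det * (M.submatrix (fun a => j.succAbove (i.succAbove a))
          (fun a => m.succAbove (k.succAbove a))).det =
      (M.submatrix i.castSucc.succAbove k.castSucc.succAbove).det *
        (M.submatrix j.succAbove m.succAbove).det -
      (M.submatrix i.castSucc.succAbove m.succAbove).det *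
        (M.submatrix j.succAbove k.castSucc.succAbove).det := by
  have h := dj_regular (Matrix.mvPolynomialX (Fin (n + 2)) (Fin (n + 2)) ℤ)
    (Matrix.det_mvPolynomialX_ne_zero _ _) j m i k hij hkm
  have h2 := congrArg (MvPolynomial.aeval fun p : Fin (n + 2) × Fin (n + 2) => M p.1 p.2) h
  have hm := Matrix.mvPolynomialX_mapMatrix_aeval (R := ℤ) M
  simp only [map_mul, map_sub, AlgHom.map_det, AlgHom.mapMatrix_apply,
    ← Matrix.submatrix_map] at h2 hm
  rw [hm] at h2
  exact h2

theorem dj_drop_last {S : Type*} [CommRing S] {n : ℕ}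
    (M : Matrix (Fin (n + 1)) (Fin (n + 1)) S) (h1 : M (Fin.last n) (Fin.last n) = 1)
    (h0 : ∀ j : Fin n, M (Fin.last n) j.castSucc = 0) :
    M.det = (M.submatrix Fin.castSucc Fin.castSucc).det := by
  rw [Matrix.det_succ_row _ (Fin.last n), Fin.sum_univ_castSucc]
  simp [h1, h0, ← two_mul]

theorem dj_det_zero {S : Type*} [CommRing S] {n : ℕ}
    (M : Matrix (Fin n) (Fin n) S) (k : Fin n) (h : ∀ i j, k ≤ i → j ≤ k → M i j = 0) :
    M.det = 0 := by
  rw [Matrix.det_apply]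
  apply Finset.sum_eq_zero
  intro σ _
  have : ∃ j, j ≤ k ∧ k ≤ σ j := by
    by_contra hc
    push Not at hc
    have := Finset.card_le_card_of_injOn (s := Finset.Iic k) (t := Finset.Iio k) σ
      (fun j hj => by simpa using hc j (by simpa using hj)) σ.injective.injOn
    simp at this
  obtain ⟨j, hj, hk⟩ := this
  have hp : ∏ i, M (σ i) i = 0 := Finset.prod_eq_zero (Finset.mem_univ j) (h _ _ hk hj)
  rw [hp, smul_zero]

theorem dj_conj_iff {f : ℕ → ℕ} {r : ℕ} (hf : Antitone f) (h0 : ∀ i, r ≤ i → f i = 0)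
    (i j : ℕ) : i < conjF f r j ↔ j < f i := by
  unfold conjF
  constructor
  · intro h
    by_contra hc
    have : ((Finset.range r).filter fun t => j + 1 ≤ f t) ⊆ Finset.range i := by
      intro t ht
      simp only [Finset.mem_filter, Finset.mem_range] at ht ⊢
      by_contra hti
      have := hf (not_lt.mp hti)
      omega
    have := Finset.card_le_card this
    simp only [Finset.card_range] at this
    omega
  · intro h
    have : Finset.range (i + 1) ⊆ ((Finset.range r).filter fun t => j + 1 ≤ f t) := by
      intro t ht
      simp only [Finset.mem_filter, Finset.mem_range] at ht ⊢
      have h1 := hf (Nat.lt_succ_iff.mp ht)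
      refine ⟨?_, by omega⟩
      by_contra hr
      have := h0 t (by omega)
      omega
    have := Finset.card_le_card this
    simp only [Finset.card_range] at this
    omega

theorem dj_conj_eq {g : ℕ → ℕ} {B i c : ℕ} (h : ∀ j, (j < B ∧ i + 1 ≤ g j) ↔ j < c) :
    conjF g B i = c := by
  unfold conjF
  have : ((Finset.range B).filter fun j => i + 1 ≤ g j) = Finset.range c := by
    ext j
    simp only [Finset.mem_filter, Finset.mem_range, h j]
  rw [this, Finset.card_range]

/-- Six descriptions of the conjugated shapes. -/
theorem dj_T1 {f : ℕ → ℕ} {r l : ℕ} (hf : Antitone f) (h0 : ∀ i, r ≤ i → f i = 0)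
    (hl : ∀ i, f i ≤ l + 1) :
    conjF (fun i => (if i < l + 1 then (conjF f r i : ℤ) else 0).toNat) (l + 1) = f := by
  funext i
  apply dj_conj_eq
  intro j
  have := dj_conj_iff hf h0 i j
  have := hl i
  split_ifs <;> omega

theorem dj_T2 {f : ℕ → ℕ} {r l : ℕ} (hf : Antitone f) (h0 : ∀ i, r ≤ i → f i = 0) :
    conjF (fun i => (if i < l - 1 then (conjF f r (i + 1) : ℤ) else 0).toNat) (l + 1) =
      fun i => min (f i - 1) (l - 1) := by
  funext i
  apply dj_conj_eq
  intro j
  have := dj_conj_iff hf h0 i (j + 1)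
  split_ifs <;> omega

theorem dj_T3 {f : ℕ → ℕ} {r l : ℕ} (hf : Antitone f) (h0 : ∀ i, r ≤ i → f i = 0) :
    conjF (fun i => (if i < l then (conjF f r i : ℤ) else 0).toNat) (l + 1) =
      fun i => min (f i) l := by
  funext i
  apply dj_conj_eq
  intro j
  have := dj_conj_iff hf h0 i j
  split_ifs <;> omega

theorem dj_T4 {f : ℕ → ℕ} {r l : ℕ} (hf : Antitone f) (h0 : ∀ i, r ≤ i → f i = 0)
    (hl : ∀ i, f i ≤ l + 1) :
    conjF (fun i => (if i < l then (conjF f r (i + 1) : ℤ) else 0).toNat) (l + 1) =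
      fun i => f i - 1 := by
  funext i
  apply dj_conj_eq
  intro j
  have := dj_conj_iff hf h0 i (j + 1)
  have := hl i
  split_ifs <;> omega

theorem dj_T5 {f : ℕ → ℕ} {r l : ℕ} (hf : Antitone f) (h0 : ∀ i, r ≤ i → f i = 0)
    (hl : ∀ i, f i ≤ l + 1) :
    conjF (fun i => (if i < l then (conjF f r (i + 1) : ℤ) - 1 else 0).toNat) (l + 1) =
      fun i => f (i + 1) - 1 := by
  funext i
  apply dj_conj_eq
  intro j
  have := dj_conj_iff hf h0 (i + 1) (j + 1)
  have := hl (i + 1)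
  split_ifs <;> omega

theorem dj_T6 {f : ℕ → ℕ} {r l : ℕ} (hf : Antitone f) (h0 : ∀ i, r ≤ i → f i = 0) :
    conjF (fun i => (if i < l then (conjF f r i : ℤ) + 1 else 0).toNat) (l + 1) =
      fun i => if i = 0 then l else min (f (i - 1)) l := by
  funext i
  apply dj_conj_eq
  intro j
  have := dj_conj_iff hf h0 (i - 1) j
  split_ifs <;> omega

/-- The master sequence. -/
def djSeq (f : ℕ → ℕ) (l r k : ℕ) : ℕ :=
  k + (if k = r + 1 then l - 1 else min (f (r - k) - 1) (l - 1))

theorem dj_succAbove_val {n : ℕ} (p : Fin (n + 1)) (i : Fin n) :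
    ((p.succAbove i : Fin (n + 1)) : ℕ) = if (i : ℕ) < p then (i : ℕ) else i + 1 := by
  unfold Fin.succAbove
  simp only [Fin.lt_def, Fin.val_castSucc]
  split_ifs <;> simp

section
variable {f : ℕ → ℕ} {l r A B : ℕ}

theorem dj_m1 (hl1 : 1 ≤ l) (hl : ∀ i, f i ≤ l + 1)
  (hA : ∀ i, i < A ↔ 0 < f i) (hB : ∀ i, i < B ↔ l < f i) (hAr : A ≤ r)
    (i : Fin (r + 1)) (j : Fin (r + 2)) (hi : (i : ℕ) = r - A) (hj : (j : ℕ) = r + 1 - B)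
    (t : Fin r) : maya f r t = djSeq f l r (j.succAbove (i.succAbove t) : Fin (r + 2)) := by
  have ht := t.2
  simp only [dj_succAbove_val, maya, djSeq, hi, hj]
  generalize (t : ℕ) = k at *
  obtain ⟨s, hs⟩ : ∃ s, r = s + 1 + k := ⟨r - 1 - k, by omega⟩
  subst hs
  have a0 : s + 1 + k - 1 - k = s := by omega
  have a1 : s + 1 + k - k = s + 1 := by omega
  have a2 : s + 1 + k - (k + 1) = s := by omega
  have a3 : s + 1 + k - (k + 1 + 1) = s - 1 := by omega
  have := hA s
  have := hA (s - 1)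
  have := hA (s + 1)
  have := hB s
  have := hB (s - 1)
  have := hB (s + 1)
  have := hl s
  have := hl (s + 1)
  have := hl (s - 1)
  split_ifs <;> simp only [a0, a1, a2, a3] <;> omega

theorem dj_m2 (t : Fin (r + 1)) : maya (fun i => min (f i - 1) (l - 1)) (r + 1) t =
    djSeq f l r (t.castSucc : Fin (r + 2)) := by
  have ht := t.2
  simp only [maya, djSeq, Fin.val_castSucc, Nat.add_sub_cancel]
  rw [if_neg (by omega)]
  omega

theorem dj_m3 (hl1 : 1 ≤ l)
    (hA : ∀ i, i < A ↔ 0 < f i) (hAr : A ≤ r)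
    (i : Fin (r + 1)) (hi : (i : ℕ) = r - A)
    (t : Fin r) : maya (fun i => min (f i) l) r t =
      djSeq f l r (i.castSucc.succAbove t.castSucc : Fin (r + 2)) := by
  have ht := t.2
  simp only [dj_succAbove_val, maya, djSeq, hi, Fin.val_castSucc]
  generalize (t : ℕ) = k at *
  obtain ⟨s, hs⟩ : ∃ s, r = s + 1 + k := ⟨r - 1 - k, by omega⟩
  subst hs
  have a0 : s + 1 + k - 1 - k = s := by omega
  have a1 : s + 1 + k - k = s + 1 := by omega
  have a2 : s + 1 + k - (k + 1) = s := by omega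
  have := hA s
  have := hA (s + 1)
  split_ifs <;> simp only [a0, a1, a2] <;> omega

theorem dj_m4 (hl1 : 1 ≤ l) (hl : ∀ i, f i ≤ l + 1)
    (hB : ∀ i, i < B ↔ l < f i) (hBr : B ≤ r)
    (j : Fin (r + 2)) (hj : (j : ℕ) = r + 1 - B)
    (t : Fin (r + 1)) : maya (fun i => f i - 1) (r + 1) t =
      djSeq f l r (j.succAbove t : Fin (r + 2)) := by
  have ht := t.2
  simp only [dj_succAbove_val, maya, djSeq, hj, Nat.add_sub_cancel]
  generalize (t : ℕ) = k at *
  obtain ⟨s, hs⟩ : ∃ s, r = s + k := ⟨r - k, by omega⟩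
  subst hs
  have a0 : s + k - k = s := by omega
  have a2 : s + k - (k + 1) = s - 1 := by omega
  have := hB s
  have := hB (s - 1)
  have := hl s
  have := hl (s - 1)
  split_ifs <;> simp only [a0, a2] <;> omega

theorem dj_m5 (hl1 : 1 ≤ l) (hl : ∀ i, f i ≤ l + 1)
    (hB : ∀ i, i < B ↔ l < f i) (hBr : B ≤ r) (hB1 : 1 ≤ B)
    (j : Fin (r + 2)) (hj : (j : ℕ) = r + 1 - B)
    (t : Fin r) : maya (fun i => f (i + 1) - 1) r t =
      djSeq f l r (j.succAbove t.castSucc : Fin (r + 2)) := by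
  have ht := t.2
  simp only [dj_succAbove_val, maya, djSeq, hj, Fin.val_castSucc]
  generalize (t : ℕ) = k at *
  obtain ⟨s, hs⟩ : ∃ s, r = s + 1 + k := ⟨r - 1 - k, by omega⟩
  subst hs
  have a0 : s + 1 + k - 1 - k = s := by omega
  have a1 : s + 1 + k - k = s + 1 := by omega
  have a2 : s + 1 + k - (k + 1) = s := by omega
  have := hB s
  have := hB (s + 1)
  have := hl s
  have := hl (s + 1)
  split_ifs <;> simp only [a0, a1, a2] <;> omega

theorem dj_m6 (hl1 : 1 ≤ l)
    (hA : ∀ i, i < A ↔ 0 < f i) (hAr : A ≤ r)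
    (i : Fin (r + 1)) (hi : (i : ℕ) = r - A)
    (t : Fin (r + 1)) : maya (fun i => if i = 0 then l else min (f (i - 1)) l) (r + 1) t =
      djSeq f l r (i.castSucc.succAbove t : Fin (r + 2)) := by
  have ht := t.2
  simp only [dj_succAbove_val, maya, djSeq, hi, Fin.val_castSucc, Nat.add_sub_cancel]
  generalize (t : ℕ) = k at *
  obtain ⟨s, hs⟩ : ∃ s, r = s + k := ⟨r - k, by omega⟩
  subst hs
  have a0 : s + k - k = s := by omega
  have a2 : s + k - (k + 1) = s - 1 := by omega
  have := hA s
  have := hA (s - 1)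
  split_ifs <;> simp only [a0, a2] at * <;> omega
end

theorem dj_matExt_lt {R : Type*} [CommRing R] {N : ℕ} {U : Matrix (Fin N) (Fin N) R}
    (hU : UpperUni U) {i j : ℕ} (h : j < i) : matExt U i j = 0 := by
  unfold matExt
  split_ifs with h1 h2
  · exact hU.2 _ _ h
  · rfl
  · rfl

theorem dj_matExt_diag {R : Type*} [CommRing R] {N : ℕ} {U : Matrix (Fin N) (Fin N) R}
    (hU : UpperUni U) {i : ℕ} (h : i < N) : matExt U i i = 1 := by
  unfold matExt
  rw [dif_pos h, dif_pos h]
  exact hU.1 _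


theorem dj_skew_eq {R : Type*} [CommRing R] {N : ℕ} (U : Matrix (Fin N) (Fin N) R)
    {r B : ℕ} {lam mu : ℕ → ℤ} {L M : ℕ → ℕ} (h : IsSkewZ B lam mu)
    (hL : conjF (fun i => (lam i).toNat) B = L) (hM : conjF (fun i => (mu i).toNat) B = M) :
    SchurVzConj U r B lam mu = SchurV U r L M := by
  unfold SchurVzConj
  rw [if_pos h, hL, hM]

/-- A minor of an upper triangular matrix vanishes when the shapes are not nested. -/
theorem dj_minor_zero {R : Type*} [CommRing R] {N : ℕ} {U : Matrix (Fin N) (Fin N) R}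
    (hU : UpperUni U) {r : ℕ} {L M : ℕ → ℕ} (hL : Antitone L) (hM : Antitone M)
    (t : ℕ) (ht : t < r) (hlt : L t < M t) : SchurV U r L M = 0 := by
  unfold SchurV
  apply dj_det_zero _ ⟨r - 1 - t, by omega⟩
  intro i j hi hj
  rw [Matrix.of_apply]
  apply dj_matExt_lt hU
  unfold maya
  have hi' : r - 1 - t ≤ (i : ℕ) := hi
  have hj' : (j : ℕ) ≤ r - 1 - t := hj
  have hi2 := i.2
  have hj2 := j.2
  have h1 : M t ≤ M (r - 1 - i) := hM (by omega)
  have h2 : L (r - 1 - j) ≤ L t := hL (by omega)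
  omega

/-- Desnanot–Jacobi quadratic relation for the ninth variation, `e`-version. -/
theorem desnanot_jacobi_e {R : Type*} [CommRing R] {N : ℕ} (hN : 0 < N)
    (U : Matrix (Fin N) (Fin N) R) (hU : UpperUni U)
    (l r : ℕ) (hl : 1 ≤ l) (hrN : r + 1 ≤ N)
    (lam mu : ℕ → ℕ)
    (hlam : ∀ i, lam (i + 1) ≤ lam i) (hmu : ∀ i, mu (i + 1) ≤ mu i)
    (hsub : ∀ i, mu i ≤ lam i)
    (hlen : ∀ i, r ≤ i → lam i = 0)
    (hconjlen : lam 0 ≤ l + 1)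
    (hht : conjF lam r 0 + 1 ≤ r)
    (hwid : lam 0 + 2 ≤ N - r) :
    SchurVzConj U r (l + 1) (fun i => if i < l + 1 then (conjF lam r i : ℤ) else 0)
        (fun i => if i < l + 1 then (conjF mu r i : ℤ) else 0) *
      SchurVzConj U (r + 1) (l + 1)
        (fun i => if i < l - 1 then (conjF lam r (i + 1) : ℤ) else 0)
        (fun i => if i < l - 1 then (conjF mu r (i + 1) : ℤ) else 0) =
    SchurVzConj U r (l + 1) (fun i => if i < l then (conjF lam r i : ℤ) else 0)
        (fun i => if i < l then (conjF mu r i : ℤ) else 0) *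
      SchurVzConj U (r + 1) (l + 1)
        (fun i => if i < l then (conjF lam r (i + 1) : ℤ) else 0)
        (fun i => if i < l then (conjF mu r (i + 1) : ℤ) else 0) -
    SchurVzConj U r (l + 1) (fun i => if i < l then (conjF lam r (i + 1) : ℤ) - 1 else 0)
        (fun i => if i < l then (conjF mu r i : ℤ) else 0) *
      SchurVzConj U (r + 1) (l + 1)
        (fun i => if i < l then (conjF lam r i : ℤ) + 1 else 0)
        (fun i => if i < l then (conjF mu r (i + 1) : ℤ) else 0) := by
  classical
  have hfl : Antitone lam := antitone_nat_of_succ_le hlam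
  have hfm : Antitone mu := antitone_nat_of_succ_le hmu
  have hlen' : ∀ i, r ≤ i → mu i = 0 := fun i hi => by
    have := hsub i
    have := hlen i hi
    omega
  have hll : ∀ i, lam i ≤ l + 1 := fun i => (hfl (Nat.zero_le i)).trans hconjlen
  have hml : ∀ i, mu i ≤ l + 1 := fun i => (hsub i).trans (hll i)
  have cl := dj_conj_iff hfl hlen
  have cm := dj_conj_iff hfm hlen'
  have ml : ∀ j, conjF lam r (j + 1) ≤ conjF lam r j := fun j => by
    by_contra h
    have h1 := cl (conjF lam r j) (j + 1)
    have h2 := cl (conjF lam r j) j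
    omega
  have mm : ∀ j, conjF mu r (j + 1) ≤ conjF mu r j := fun j => by
    by_contra h
    have h1 := cm (conjF mu r j) (j + 1)
    have h2 := cm (conjF mu r j) j
    omega
  have sml : ∀ j, conjF mu r j ≤ conjF lam r j := fun j => by
    by_contra h
    have h1 := cm (conjF lam r j) j
    have h2 := cl (conjF lam r j) j
    have h3 := hsub (conjF lam r j)
    omega
  have S1 := dj_skew_eq (r := r) U (B := l + 1)
    (lam := fun i => if i < l + 1 then (conjF lam r i : ℤ) else 0)
    (mu := fun i => if i < l + 1 then (conjF mu r i : ℤ) else 0)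
    (by
      refine ⟨⟨fun i => ?_, fun i => ?_, fun i hi => ?_⟩,
        ⟨fun i => ?_, fun i => ?_, fun i hi => ?_⟩, fun i => ?_⟩ <;> dsimp only <;>
      have h1 := ml i <;> have h2 := mm i <;> have h3 := sml i <;>
      split_ifs <;> omega) (dj_T1 hfl hlen hll) (dj_T1 hfm hlen' hml)
  have S2 := dj_skew_eq (r := r + 1) U (B := l + 1)
    (lam := fun i => if i < l - 1 then (conjF lam r (i + 1) : ℤ) else 0)
    (mu := fun i => if i < l - 1 then (conjF mu r (i + 1) : ℤ) else 0)
    (by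
      refine ⟨⟨fun i => ?_, fun i => ?_, fun i hi => ?_⟩,
        ⟨fun i => ?_, fun i => ?_, fun i hi => ?_⟩, fun i => ?_⟩ <;> dsimp only <;>
      have h1 := ml (i + 1) <;> have h2 := mm (i + 1) <;> have h3 := sml (i + 1) <;>
      split_ifs <;> omega) (dj_T2 hfl hlen) (dj_T2 hfm hlen')
  have S3 := dj_skew_eq (r := r) U (B := l + 1)
    (lam := fun i => if i < l then (conjF lam r i : ℤ) else 0)
    (mu := fun i => if i < l then (conjF mu r i : ℤ) else 0)
    (by
      refine ⟨⟨fun i => ?_, fun i => ?_, fun i hi => ?_⟩,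
        ⟨fun i => ?_, fun i => ?_, fun i hi => ?_⟩, fun i => ?_⟩ <;> dsimp only <;>
      have h1 := ml i <;> have h2 := mm i <;> have h3 := sml i <;>
      split_ifs <;> omega) (dj_T3 hfl hlen) (dj_T3 hfm hlen')
  have S4 := dj_skew_eq (r := r + 1) U (B := l + 1)
    (lam := fun i => if i < l then (conjF lam r (i + 1) : ℤ) else 0)
    (mu := fun i => if i < l then (conjF mu r (i + 1) : ℤ) else 0)
    (by
      refine ⟨⟨fun i => ?_, fun i => ?_, fun i hi => ?_⟩,
        ⟨fun i => ?_, fun i => ?_, fun i hi => ?_⟩, fun i => ?_⟩ <;> dsimp only <;>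
      have h1 := ml (i + 1) <;> have h2 := mm (i + 1) <;> have h3 := sml (i + 1) <;>
      split_ifs <;> omega) (dj_T4 hfl hlen hll) (dj_T4 hfm hlen' hml)
  have S6 := dj_skew_eq (r := r + 1) U (B := l + 1)
    (lam := fun i => if i < l then (conjF lam r i : ℤ) + 1 else 0)
    (mu := fun i => if i < l then (conjF mu r (i + 1) : ℤ) else 0)
    (by
      refine ⟨⟨fun i => ?_, fun i => ?_, fun i hi => ?_⟩,
        ⟨fun i => ?_, fun i => ?_, fun i hi => ?_⟩, fun i => ?_⟩ <;> dsimp only <;>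
      have h1 := ml i <;> have h2 := mm (i + 1) <;> have h3 := sml i <;> have h4 := mm i <;>
      split_ifs <;> omega) (dj_T6 hfl hlen) (dj_T4 hfm hlen' hml)
  rw [S1, S2, S3, S4, S6]
  by_cases hcase : lam 0 ≤ l
  · -- the trivial case
    have S5 : SchurVzConj U r (l + 1)
        (fun i => if i < l then (conjF lam r (i + 1) : ℤ) - 1 else 0)
        (fun i => if i < l then (conjF mu r i : ℤ) else 0) = 0 := by
      unfold SchurVzConj
      rw [if_neg]
      rintro ⟨⟨-, h, -⟩, -⟩
      have h := h (l - 1)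
      dsimp only at h
      rw [if_pos (by omega), Nat.sub_add_cancel hl] at h
      have := cl 0 l
      omega
    have hle : ∀ i, lam i ≤ l := fun i => (hfl (Nat.zero_le i)).trans hcase
    have e1 : (fun i => min (lam i) l) = lam := funext fun i => by have := hle i; omega
    have e2 : (fun i => min (mu i) l) = mu := funext fun i => by
      have := hle i
      have := hsub i
      omega
    have e3 : (fun i => min (lam i - 1) (l - 1)) = fun i => lam i - 1 := funext fun i => by
      have := hle i
      omega
    have e4 : (fun i => min (mu i - 1) (l - 1)) = fun i => mu i - 1 := funext fun i => by
      have := hle i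
      have := hsub i
      omega
    rw [S5, e1, e2, e3, e4]
    ring
  · have hB1 : 1 ≤ conjF lam r l := (cl 0 l).mpr (by omega)
    have S5 : SchurVzConj U r (l + 1)
        (fun i => if i < l then (conjF lam r (i + 1) : ℤ) - 1 else 0)
        (fun i => if i < l then (conjF mu r i : ℤ) else 0) =
        SchurV U r (fun i => lam (i + 1) - 1) (fun i => min (mu i) l) := by
      by_cases hsk : IsSkewZ (l + 1)
        (fun i => if i < l then (conjF lam r (i + 1) : ℤ) - 1 else 0)
        (fun i => if i < l then (conjF mu r i : ℤ) else 0)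
      · exact dj_skew_eq U hsk (dj_T5 hfl hlen hll) (dj_T3 hfm hlen')
      · have hz : SchurVzConj U r (l + 1)
            (fun i => if i < l then (conjF lam r (i + 1) : ℤ) - 1 else 0)
            (fun i => if i < l then (conjF mu r i : ℤ) else 0) = 0 := by
          unfold SchurVzConj
          rw [if_neg hsk]
        rw [hz]
        have hge : ∀ i, i < l → 1 ≤ conjF lam r (i + 1) := fun i hi =>
          (cl 0 (i + 1)).mpr (by omega)
        have hex : ∃ i, i < l ∧ conjF lam r (i + 1) ≤ conjF mu r i := by
          by_contra hc
          push Not at hc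
          apply hsk
          refine ⟨⟨fun i => ?_, fun i => ?_, fun i hi => ?_⟩,
            ⟨fun i => ?_, fun i => ?_, fun i hi => ?_⟩, fun i => ?_⟩ <;> dsimp only <;>
          have h1 := ml (i + 1) <;> have h2 := mm i <;> have h3 := hc i <;>
          have h4 := hge i <;> split_ifs <;> omega
        obtain ⟨i, hi, hle⟩ := hex
        have h1 := hge i hi
        have h2 := (cm (conjF mu r i - 1) i).mp (by omega)
        have h3 := cl (conjF mu r i - 1 + 1) (i + 1)
        have ht : conjF mu r i - 1 < r := by
          by_contra hr
          have := hlen' (conjF mu r i - 1) (by omega)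
          omega
        symm
        apply dj_minor_zero hU (t := conjF mu r i - 1) _ _ ht
        · show lam (conjF mu r i - 1 + 1) - 1 < min (mu (conjF mu r i - 1)) l
          omega
        · intro a b hab
          have : lam (b + 1) ≤ lam (a + 1) := hfl (by omega)
          show lam (b + 1) - 1 ≤ lam (a + 1) - 1
          omega
        · intro a b hab
          have : mu b ≤ mu a := hfm hab
          show min (mu b) l ≤ min (mu a) l
          omega
    rw [S5]
    clear S1 S2 S3 S4 S5 S6
    have mono0 : ∀ (g : ℕ → ℕ), (∀ j, g (j + 1) ≤ g j) → g l ≤ g 0 := fun g hg =>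
      antitone_nat_of_succ_le hg (Nat.zero_le l)
    have hAB := mono0 _ ml
    have hAB' := mono0 _ mm
    have hs0 := sml 0
    have hsl := sml l
    set A := conjF lam r 0 with hA
    set B := conjF lam r l with hB
    set A' := conjF mu r 0 with hA'
    set B' := conjF mu r l with hB'
    have cA : ∀ i, i < A ↔ 0 < lam i := fun i => cl i 0
    have cB : ∀ i, i < B ↔ l < lam i := fun i => cl i l
    have cA' : ∀ i, i < A' ↔ 0 < mu i := fun i => cm i 0
    have cB' : ∀ i, i < B' ↔ l < mu i := fun i => cm i l
    obtain ⟨i, hi⟩ : ∃ i : Fin (r + 1), (i : ℕ) = r - A' := ⟨⟨r - A', by omega⟩, rfl⟩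
    obtain ⟨j, hj⟩ : ∃ j : Fin (r + 2), (j : ℕ) = r + 1 - B' := ⟨⟨r + 1 - B', by omega⟩, rfl⟩
    obtain ⟨k, hk⟩ : ∃ k : Fin (r + 1), (k : ℕ) = r - A := ⟨⟨r - A, by omega⟩, rfl⟩
    obtain ⟨m, hm⟩ : ∃ m : Fin (r + 2), (m : ℕ) = r + 1 - B := ⟨⟨r + 1 - B, by omega⟩, rfl⟩
    let M : Matrix (Fin (r + 2)) (Fin (r + 2)) R :=
      Matrix.of fun a b => matExt U (djSeq mu l r a) (djSeq lam l r b)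
    have hlast : ∀ f : ℕ → ℕ, djSeq f l r (r + 1) = r + l := fun f => by
      unfold djSeq
      rw [if_pos rfl]
      omega
    have hsmall : ∀ (f : ℕ → ℕ) (t : ℕ), t < r + 1 → djSeq f l r t < r + l := fun f t ht => by
      unfold djSeq
      rw [if_neg (by omega)]
      omega
    have ML : ∀ a b : Fin (r + 2), (a : ℕ) = r + 1 → (b : ℕ) = r + 1 → M a b = 1 := by
      intro a b ha hb
      show matExt U (djSeq mu l r a) (djSeq lam l r b) = 1
      rw [ha, hb, hlast, hlast]
      exact dj_matExt_diag hU (by omega)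
    have M0 : ∀ a b : Fin (r + 2), (a : ℕ) = r + 1 → (b : ℕ) < r + 1 → M a b = 0 := by
      intro a b ha hb
      show matExt U (djSeq mu l r a) (djSeq lam l r b) = 0
      rw [ha, hlast]
      exact dj_matExt_lt hU (hsmall _ _ hb)
    have key := dj_general M j m i k (by omega) (by omega)
    have D2 : M.det = SchurV U (r + 1) (fun i => min (lam i - 1) (l - 1))
        (fun i => min (mu i - 1) (l - 1)) := by
      rw [dj_drop_last M (ML _ _ rfl rfl) (fun t => M0 _ _ rfl t.2)]
      unfold SchurV
      congr 1
      ext a b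
      rw [Matrix.of_apply, dj_m2, dj_m2]
      rfl
    have D1 : (M.submatrix (fun a => j.succAbove (i.succAbove a))
          (fun a => m.succAbove (k.succAbove a))).det = SchurV U r lam mu := by
      unfold SchurV
      congr 1
      ext a b
      rw [Matrix.of_apply, dj_m1 hl hml cA' cB' (by omega) i j hi hj,
        dj_m1 hl hll cA cB (by omega) k m hk hm]
      rfl
    have D4 : (M.submatrix j.succAbove m.succAbove).det =
        SchurV U (r + 1) (fun i => lam i - 1) (fun i => mu i - 1) := by
      unfold SchurV
      congr 1
      ext a b
      rw [Matrix.of_apply, dj_m4 hl hml cB' (by omega) j hj,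
        dj_m4 hl hll cB (by omega) m hm]
      rfl
    have D6 : (M.submatrix j.succAbove k.castSucc.succAbove).det =
        SchurV U (r + 1) (fun i => if i = 0 then l else min (lam (i - 1)) l)
          (fun i => mu i - 1) := by
      unfold SchurV
      congr 1
      ext a b
      rw [Matrix.of_apply, dj_m4 hl hml cB' (by omega) j hj,
        dj_m6 hl cA (by omega) k hk]
      rfl
    have D3 : (M.submatrix i.castSucc.succAbove k.castSucc.succAbove).det =
        SchurV U r (fun i => min (lam i) l) (fun i => min (mu i) l) := by
      rw [dj_drop_last]
      · unfold SchurV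
        congr 1
        ext a b
        rw [Matrix.of_apply, dj_m3 hl cA' (by omega) i hi, dj_m3 hl cA (by omega) k hk]
        rfl
      · apply ML <;> rw [dj_succAbove_val] <;> simp only [Fin.val_last, Fin.val_castSucc] <;>
          rw [if_neg (by omega)]
      · intro t
        have ht := t.2
        apply M0 <;> rw [dj_succAbove_val] <;> simp only [Fin.val_last, Fin.val_castSucc] <;>
          split_ifs <;> omega
    have D5 : (M.submatrix i.castSucc.succAbove m.succAbove).det =
        SchurV U r (fun i => lam (i + 1) - 1) (fun i => min (mu i) l) := by
      rw [dj_drop_last]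
      · unfold SchurV
        congr 1
        ext a b
        rw [Matrix.of_apply, dj_m3 hl cA' (by omega) i hi,
          dj_m5 hl hll cB (by omega) hB1 m hm]
        rfl
      · apply ML <;> rw [dj_succAbove_val] <;> simp only [Fin.val_last, Fin.val_castSucc] <;>
          rw [if_neg (by omega)]
      · intro t
        have ht := t.2
        apply M0 <;> rw [dj_succAbove_val] <;> simp only [Fin.val_last, Fin.val_castSucc] <;>
          split_ifs <;> omega
    rw [D1, D2, D3, D4, D5, D6] at key
    rw [← key]
    ring
end

section
/- Quadratic relation from the Giambelli determinant, non-skew case (Theorem 3.5(1)): Let R be a commutative ring, N a positive integer, U an N×N upper unitriangular matrix over R, and r an integer. Let p ≥ 2 and let α = (α_1 > ⋯ > α_p ≥ 0) and β = (β_1 > ⋯ > β_p ≥ 0) be strictly decreasing sequences of nonnegative integers with β_1 + 1 ≤ r and α_1 + 1 ≤ N − r. Writing ⁻α = (α_2,…,α_p), α⁻ = (α_1,…,α_{p−1}), ⁻α⁻ = (α_2,…,α_{p−1}) (and similarly for β), and (α|β) for the partition with Frobenius coordinates (α,β), one has S^{(r)}_{(α|β)}(U) · S^{(r)}_{(⁻α⁻|⁻β⁻)}(U)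 = S^{(r)}_{(α⁻|β⁻)}(U) · S^{(r)}_{(⁻α|⁻β)}(U) − S^{(r)}_{(⁻α|β⁻)}(U) · S^{(r)}_{(α⁻|⁻β)}(U). -/
open Matrix BigOperators Finset Filter

theorem det_partial_diag {R : Type*} [CommRing R] {r p : ℕ} (f : Fin p → Fin r)
    (hf : Function.Injective f) (d : R) (M : Matrix (Fin r) (Fin r) R)
    (hM : ∀ j, j ∉ Set.range f → ∀ i, M i j = if i = j then d else 0) :
    M.det = d ^ (r - p) * (M.submatrix f f).det := by
  classical
  rw [Matrix.twoBlockTriangular_det' M (fun i => i ∈ Set.range f)]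
  swap
  · intro i hi j hj
    rw [hM j hj, if_neg]
    rintro rfl
    exact hj hi
  rw [mul_comm]
  congr 1
  · have h1 : (Matrix.toSquareBlockProp M fun i => ¬ i ∈ Set.range f) = d • 1 := by
      ext i j
      simp only [Matrix.toSquareBlockProp_def, Matrix.of_apply, hM j.1 j.2]
      simp [Matrix.one_apply, Subtype.ext_iff]
    rw [h1, Matrix.det_smul, Matrix.det_one, mul_one, Fintype.card_subtype_compl]
    congr 2
    · simp
    · rw [Fintype.card_congr (Equiv.ofInjective f hf).symm, Fintype.card_fin]
  · let e : Fin p ≃ {i // i ∈ Set.range f} := Equiv.ofInjective f hf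
    have h2 := (Matrix.det_submatrix_equiv_self e
      (Matrix.toSquareBlockProp M fun i => i ∈ Set.range f)).symm
    convert! h2

theorem desnanot_mul {R : Type*} [CommRing R] {n : ℕ} (M : Matrix (Fin (n+2)) (Fin (n+2)) R) :
    M.det * ((M.submatrix Fin.castSucc Fin.castSucc).det * (M.submatrix Fin.succ Fin.succ).det
      - (M.submatrix Fin.castSucc Fin.succ).det * (M.submatrix Fin.succ Fin.castSucc).det) =
    M.det * (M.det * (M.submatrix (fun i : Fin n => i.castSucc.succ) (fun i : Fin n => i.castSucc.succ)).det) := by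
  classical
  let B : Matrix (Fin (n+2)) (Fin (n+2)) R := Matrix.of fun i j =>
    if j = 0 ∨ j = Fin.last _ then M.adjugate i j else if i = j then 1 else 0
  have h1 : B.det = (M.submatrix Fin.castSucc Fin.castSucc).det * (M.submatrix Fin.succ Fin.succ).det
      - (M.submatrix Fin.castSucc Fin.succ).det * (M.submatrix Fin.succ Fin.castSucc).det := by
    rw [det_partial_diag (p := 2) ![0, Fin.last _] _ 1 B, Matrix.det_fin_two]
    · simp [B, Matrix.adjugate_fin_succ_eq_det_submatrix, Fin.succAbove_last, Fin.succAbove_zero]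
      have : ((-1 : R) ^ (n+1)) * (-1) ^ (n+1) = 1 := by
        rw [← mul_pow]; simp
      linear_combination (-(M.submatrix Fin.castSucc Fin.succ).det * (M.submatrix Fin.succ Fin.castSucc).det) * this
    · intro j hj i
      simp at hj
      simp [B, hj.1, hj.2]
    · intro a b
      fin_cases a <;> fin_cases b <;> simp [Fin.ext_iff]
  have h2 : (M * B).det = M.det ^ 2 * (M.submatrix (fun i : Fin n => i.castSucc.succ) (fun i : Fin n => i.castSucc.succ)).det := by
    rw [det_partial_diag (p := n) (fun i : Fin n => i.castSucc.succ) _ M.det (M * B)]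
    · congr 1
      · congr 1; omega
      · congr 1
        ext i j
        have hj : ¬ (j.castSucc.succ = 0 ∨ j.castSucc.succ = Fin.last (n+1)) := by
          simp [Fin.ext_iff]; omega
        simp only [Matrix.submatrix_apply, Matrix.mul_apply, B, Matrix.of_apply, if_neg hj]
        simp
    · intro j hj i
      have hj : j = 0 ∨ j = Fin.last (n+1) := by
        by_contra h
        push Not at h
        apply hj
        have h0 : (j : ℕ) ≠ 0 := fun h' => h.1 (Fin.ext h')
        have h1 : (j : ℕ) ≠ n+1 := fun h' => h.2 (Fin.ext h')
        exact ⟨⟨j - 1, by omega⟩, by ext; simp; omega⟩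
      have : (M * B) i j = (M * M.adjugate) i j := by
        simp only [Matrix.mul_apply, B, Matrix.of_apply, if_pos hj]
      rw [this, Matrix.mul_adjugate]
      simp [Matrix.one_apply]
    · intro a b h
      simpa [Fin.ext_iff] using h
  rw [← h1, ← Matrix.det_mul, h2]
  ring

theorem desnanot {R : Type*} [CommRing R] {n : ℕ} (M : Matrix (Fin (n+2)) (Fin (n+2)) R) :
    M.det * (M.submatrix (fun i : Fin n => i.castSucc.succ) (fun i : Fin n => i.castSucc.succ)).det =
    ((M.submatrix Fin.castSucc Fin.castSucc).det * (M.submatrix Fin.succ Fin.succ).det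
      - (M.submatrix Fin.castSucc Fin.succ).det * (M.submatrix Fin.succ Fin.castSucc).det) := by
  have h := mul_left_cancel₀ (Matrix.det_mvPolynomialX_ne_zero (Fin (n+2)) ℤ) (desnanot_mul (Matrix.mvPolynomialX (Fin (n+2)) (Fin (n+2)) ℤ))
  have h' := congrArg (MvPolynomial.eval₂Hom (Int.castRingHom R) (fun p : Fin (n+2) × Fin (n+2) => M p.1 p.2)) h
  have key : (Matrix.mvPolynomialX (Fin (n+2)) (Fin (n+2)) ℤ).map (MvPolynomial.eval₂Hom (Int.castRingHom R) (fun p : Fin (n+2) × Fin (n+2) => M p.1 p.2)) = M := by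
    ext i j
    simp [Matrix.mvPolynomialX]
  simp only [map_sub, map_mul, RingHom.map_det, RingHom.mapMatrix_apply, ← Matrix.submatrix_map, key] at h'
  exact h'.symm


/-- Columns `0..r-1` with column `r-1-b j` replaced by column `r + a j`. -/
def cF (r : ℕ) : (p : ℕ) → (Fin p → ℕ) → (Fin p → ℕ) → ℕ → ℕ
  | 0, _, _ => fun i => i
  | p + 1, a, b => Function.update (cF r p (fun j => a j.succ) (fun j => b j.succ))
      (r - 1 - b 0) (r + a 0)

theorem cF_of_ne (r : ℕ) : ∀ (p : ℕ) (a b : Fin p → ℕ) (i : ℕ), (∀ j, i ≠ r - 1 - b j) →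
    cF r p a b i = i
  | 0, _, _, i, _ => rfl
  | p + 1, a, b, i, h => by
    rw [cF, Function.update_of_ne (h 0)]
    exact cF_of_ne r p _ _ i (fun j => h j.succ)

theorem cF_of_eq (r : ℕ) : ∀ (p : ℕ) (a b : Fin p → ℕ), StrictAnti b → (∀ j, b j < r) →
    ∀ j, cF r p a b (r - 1 - b j) = r + a j
  | 0, _, _, _, _, j => j.elim0
  | p + 1, a, b, hb, hr, j => by
    rw [cF]
    induction j using Fin.cases with
    | zero => simp
    | succ j =>
      have h1 : b j.succ < b 0 := hb (Fin.succ_pos j)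
      have h2 := hr 0
      rw [Function.update_of_ne (by omega)]
      exact cF_of_eq r p (fun j => a j.succ) (fun j => b j.succ)
        (fun x y h => hb (Fin.succ_lt_succ_iff.mpr h)) (fun j => hr j.succ) j

theorem anti_bound {p : ℕ} (b : Fin p → ℕ) (hb : StrictAnti b) (j k : Fin p) (h : j ≤ k) :
    b k + (k : ℕ) ≤ b j + (j : ℕ) := by
  obtain ⟨k, hk⟩ := k
  induction k with
  | zero =>
    have : j = ⟨0, hk⟩ := le_antisymm h (Fin.mk_le_mk.mpr (Nat.zero_le _))
    rw [this]
  | succ k ih =>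
    rcases h.lt_or_eq with h | rfl
    · have h1 := ih (by omega) (by rw [Fin.lt_def] at h; rw [Fin.le_def]; simp at h ⊢; omega)
      have h2 : b ⟨k + 1, hk⟩ < b ⟨k, by omega⟩ := hb (by simp [Fin.lt_def])
      simp at h1 ⊢
      omega
    · rfl

theorem frobP_zero {p : ℕ} (a b : Fin (p + 1) → ℕ) : frobP (p + 1) a b 0 = a 0 + 1 := by
  simp [frobP]

theorem frobP_big {p : ℕ} (a b : Fin (p + 1) → ℕ) (hb : StrictAnti b) (i : ℕ) (hi : b 0 < i) :
    frobP (p + 1) a b i = 0 := by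
  have h := anti_bound b hb 0 (Fin.last p) (Fin.zero_le _)
  simp at h
  have hip : ¬ i < p + 1 := by omega
  rw [frobP, dif_neg hip, Finset.card_eq_zero, Finset.filter_eq_empty_iff]
  intro j _
  have := anti_bound b hb 0 j (Fin.zero_le _)
  simp at this
  omega

theorem frobP_succ {p : ℕ} (a b : Fin (p + 1) → ℕ) (i : ℕ) (hi : i < b 0) :
    frobP (p + 1) a b (i + 1) = frobP p (fun j => a j.succ) (fun j => b j.succ) i + 1 := by
  unfold frobP
  by_cases h : i < p
  · rw [dif_pos h, dif_pos (by omega)]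
    simp
    omega
  · rw [dif_neg h, dif_neg (by omega), Fin.univ_succ, Finset.filter_cons, if_pos (by simp; omega),
      Finset.card_cons, Finset.filter_map, Finset.card_map]
    congr 3
    ext j
    simp
    omega

theorem frobP_high {p : ℕ} (a b : Fin p → ℕ) (c i : ℕ) (hb : StrictAnti b) (hc : ∀ j, b j < c)
    (hi : c ≤ i) : frobP p a b i = 0 := by
  cases p with
  | zero => simp [frobP]
  | succ p => exact frobP_big a b hb i (lt_of_lt_of_le (hc 0) hi)

theorem maya_perm (r : ℕ) : ∀ (p : ℕ) (a b : Fin p → ℕ), StrictAnti b → (∀ j, b j < r) →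
    ∃ σ : Equiv.Perm (Fin r), Equiv.Perm.sign σ = (-1) ^ (∑ j, b j) ∧
      (∀ k : Fin r, (∀ j, (k : ℕ) < r - 1 - b j) → σ k = k) ∧
      ∀ i : Fin r, maya (frobP p a b) r i = cF r p a b (σ i)
  | 0, a, b, _, _ => ⟨1, by simp, by simp, by simp [maya, frobP, cF]⟩
  | p + 1, a, b, hb, hr => by
    have hb' : StrictAnti (fun j : Fin p => b j.succ) :=
      fun x y h => hb (Fin.succ_lt_succ_iff.mpr h)
    obtain ⟨σ, h1, h2, h3⟩ := maya_perm r p (fun j => a j.succ) (fun j => b j.succ) hb'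
      (fun j => hr j.succ)
    have hr0 := hr 0
    have : NeZero r := ⟨by omega⟩
    let k : Fin r := ⟨r - 1 - b 0, by omega⟩
    let l : Fin r := ⟨r - 1, by omega⟩
    have hkl : k ≤ l := by simp [k, l, Fin.le_def]
    have hlt : ∀ j : Fin p, b j.succ < b 0 := fun j => hb (Fin.succ_pos j)
    have hσk : σ k = k := h2 k (fun j => by
      have := hlt j
      simp [k]
      omega)
    refine ⟨σ * Fin.cycleIcc k l, ?_, ?_, ?_⟩
    · rw [Equiv.Perm.sign_mul, h1, Fin.sign_cycleIcc_of_le hkl, Fin.sum_univ_succ, pow_add,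
        mul_comm]
      congr 2
      simp [k, l]
      omega
    · intro i hi
      have hik : i < k := hi 0
      rw [Equiv.Perm.mul_apply, Fin.cycleIcc_of_lt hik]
      exact h2 i (fun j => hi j.succ)
    · intro i
      rw [Equiv.Perm.mul_apply, cF]
      rcases lt_or_ge i k with hik | hik
      · have hne : σ i ≠ k := fun h => by
          rw [← hσk] at h
          exact absurd (σ.injective h) hik.ne
        have hik' : (i : ℕ) < r - 1 - b 0 := hik
        rw [Fin.cycleIcc_of_lt hik, Function.update_of_ne (fun h => hne (Fin.ext h)), ← h3, maya,
          maya, frobP_big a b hb _ (by omega), frobP_high _ _ (b 0) _ hb' hlt (by omega)]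
      · rcases lt_or_ge i l with hil | hil
        · rw [Fin.cycleIcc_of_ge_of_lt hik hil]
          have hik' : r - 1 - b 0 ≤ (i : ℕ) := hik
          have hil' : (i : ℕ) < r - 1 := hil
          have hv : ((i + 1 : Fin r) : ℕ) = i + 1 := by
            rw [Fin.val_add_one_of_lt']
            omega
          have hne : σ (i + 1) ≠ k := fun h => by
            rw [← hσk] at h
            have := congrArg Fin.val (σ.injective h)
            rw [hv] at this
            simp [k] at this
            omega
          rw [Function.update_of_ne (fun h => hne (Fin.ext h)), ← h3, maya, maya, hv,
            show r - 1 - (i : ℕ) = (r - 1 - (i + 1)) + 1 by omega, frobP_succ a b _ (by omega)]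
          omega
        · have : i = l := le_antisymm (by have := i.isLt; simp [l, Fin.le_def]; omega) hil
          subst this
          rw [Fin.cycleIcc_of_last hkl, hσk]
          simp [k, l, maya, frobP_zero]
          omega

/-- The top-left unitriangular block. -/
def topT {R : Type*} [CommRing R] {N : ℕ} (U : Matrix (Fin N) (Fin N) R) (r : ℕ) :
    Matrix (Fin r) (Fin r) R := Matrix.of fun i j => matExt U i j

theorem det_topT {R : Type*} [CommRing R] {N : ℕ} (U : Matrix (Fin N) (Fin N) R)
    (hU : UpperUni U) (r : ℕ) (hrN : r ≤ N) : (topT U r).det = 1 := by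
  rw [Matrix.det_of_isUpperTriangular]
  · apply Finset.prod_eq_one
    intro i _
    have : (i : ℕ) < N := by omega
    simp [topT, matExt, this, hU.1]
  · intro i j hij
    have h1 : (i : ℕ) < N := by omega
    have h2 : (j : ℕ) < N := by omega
    simp only [topT, matExt, Matrix.of_apply, dif_pos h1, dif_pos h2]
    exact hU.2 _ _ hij

/-- Giambelli kernel. -/
noncomputable def gK {R : Type*} [CommRing R] {N : ℕ} (U : Matrix (Fin N) (Fin N) R) (r : ℕ)
    (b a : ℕ) : R :=
  (-1) ^ b * if h : r - 1 - b < r then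
    ((topT U r)⁻¹ *ᵥ fun k : Fin r => matExt U k (r + a)) ⟨r - 1 - b, h⟩ else 0

theorem schur_giambelli {R : Type*} [CommRing R] {N : ℕ} (U : Matrix (Fin N) (Fin N) R)
    (hU : UpperUni U) (r : ℕ) (hrN : r ≤ N) (p : ℕ) (a b : Fin p → ℕ) (hb : StrictAnti b)
    (hr : ∀ j, b j < r) :
    SchurV U r (frobP p a b) (fun _ => 0) =
      (Matrix.of fun i j : Fin p => gK U r (b i) (a j)).det := by
  obtain ⟨σ, h1, -, h3⟩ := maya_perm r p a b hb hr
  have hT := det_topT U hU r hrN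
  have hTu : IsUnit (topT U r).det := by rw [hT]; exact isUnit_one
  let C : Matrix (Fin r) (Fin r) R := Matrix.of fun i j => matExt U i (cF r p a b j)
  have hS : SchurV U r (frobP p a b) (fun _ => 0) = (-1) ^ (∑ j, b j) * C.det := by
    have := Matrix.det_permute' σ C
    rw [h1] at this
    push_cast at this
    rw [← this, SchurV]
    congr 1
    ext i j
    simp [C, h3]
    simp [maya]
  let f : Fin p → Fin r := fun j => ⟨r - 1 - b j, by have := hr j; omega⟩
  have hf : Function.Injective f := by
    intro x y h
    have h' := congrArg Fin.val h
    have hx := hr x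
    have hy := hr y
    simp [f] at h'
    exact hb.injective (by omega)
  have hC : C.det = ((topT U r)⁻¹ * C).det := by
    rw [Matrix.det_mul, Matrix.det_nonsing_inv, hT]
    simp
  have hcol : ∀ j i, ((topT U r)⁻¹ * C) i j =
      ((topT U r)⁻¹ *ᵥ fun k : Fin r => matExt U k (cF r p a b j)) i := by
    intro j i
    simp [Matrix.mul_apply, Matrix.mulVec, dotProduct, C]
  rw [hS, hC, det_partial_diag f hf 1]
  · have hg : (Matrix.of fun i j : Fin p => gK U r (b i) (a j)) =
        Matrix.of fun i j : Fin p => (-1) ^ b i * ((topT U r)⁻¹ * C).submatrix f f i j := by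
      ext i j
      have hi := hr i
      have : r - 1 - b i < r := by omega
      simp only [Matrix.of_apply, gK, dif_pos this, Matrix.submatrix_apply, hcol]
      have : cF r p a b (f j : ℕ) = r + a j := cF_of_eq r p a b hb hr j
      rw [this]
    rw [hg, Matrix.det_mul_column (fun i => (-1) ^ b i), Finset.prod_pow_eq_pow_sum]
    simp
  · intro j hj i
    have : cF r p a b j = j := cF_of_ne r p a b j (fun k h => hj ⟨k, Fin.ext h.symm⟩)
    rw [hcol, this]
    have h4 : ((topT U r)⁻¹ * topT U r) i j = (1 : Matrix (Fin r) (Fin r) R) i j := by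
      rw [Matrix.nonsing_inv_mul _ hTu]
    rw [Matrix.one_apply] at h4
    rw [← h4]
    simp [Matrix.mul_apply, Matrix.mulVec, dotProduct, topT]

/-- Quadratic relation from the Giambelli determinant, non-skew case. -/
theorem giambelli_quadratic_nonskew {R : Type*} [CommRing R] {N : ℕ} (hN : 0 < N)
    (U : Matrix (Fin N) (Fin N) R) (hU : UpperUni U)
    (r : ℕ) (hrN : r ≤ N)
    (p : ℕ) (hp : 2 ≤ p)
    (α β : Fin p → ℕ) (hα : StrictAnti α) (hβ : StrictAnti β)
    (hht : β ⟨0, by omega⟩ + 1 ≤ r) (hwid : α ⟨0, by omega⟩ + 1 ≤ N - r) :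
    SchurV U r (frobP p α β) (fun _ => 0) *
      SchurV U r (frobP (p - 2) (fun j => α ⟨(j : ℕ) + 1, by have := j.isLt; omega⟩)
        (fun j => β ⟨(j : ℕ) + 1, by have := j.isLt; omega⟩)) (fun _ => 0) =
    SchurV U r (frobP (p - 1) (fun j => α ⟨(j : ℕ), by have := j.isLt; omega⟩)
        (fun j => β ⟨(j : ℕ), by have := j.isLt; omega⟩)) (fun _ => 0) *
      SchurV U r (frobP (p - 1) (fun j => α ⟨(j : ℕ) + 1, by have := j.isLt; omega⟩)
        (fun j => β ⟨(j : ℕ) + 1, by have := j.isLt; omega⟩)) (fun _ => 0) -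
    SchurV U r (frobP (p - 1) (fun j => α ⟨(j : ℕ) + 1, by have := j.isLt; omega⟩)
        (fun j => β ⟨(j : ℕ), by have := j.isLt; omega⟩)) (fun _ => 0) *
      SchurV U r (frobP (p - 1) (fun j => α ⟨(j : ℕ), by have := j.isLt; omega⟩)
        (fun j => β ⟨(j : ℕ) + 1, by have := j.isLt; omega⟩)) (fun _ => 0) := by
  obtain ⟨n, rfl⟩ : ∃ n, p = n + 2 := ⟨p - 2, by omega⟩
  have hr : ∀ j, β j < r := fun j => by
    have := hβ.antitone (Fin.zero_le j)
    have h0 : β 0 + 1 ≤ r := hht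
    omega
  have hr1 : ∀ (q : ℕ) (g : Fin q → Fin (n + 2)), StrictMono g →
      StrictAnti (fun j => β (g j)) := fun q g hg x y h => hβ (hg h)
  have key := fun (q : ℕ) (a : Fin q → ℕ) (g : Fin q → Fin (n + 2)) (hg : StrictMono g) =>
    schur_giambelli U hU r hrN q a (fun j => β (g j)) (hr1 q g hg) (fun j => hr (g j))
  have hs : StrictMono (fun j : Fin (n + 1) => (⟨(j : ℕ) + 1, by omega⟩ : Fin (n + 2))) :=
    fun _ _ h => Fin.mk_lt_mk.mpr (Nat.succ_lt_succ h)
  have hc : StrictMono (fun j : Fin (n + 1) => (⟨(j : ℕ), by omega⟩ : Fin (n + 2))) :=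
    fun _ _ h => Fin.mk_lt_mk.mpr h
  have hm : StrictMono (fun j : Fin n => (⟨(j : ℕ) + 1, by omega⟩ : Fin (n + 2))) :=
    fun _ _ h => Fin.mk_lt_mk.mpr (Nat.succ_lt_succ h)
  have D := desnanot (Matrix.of fun i j : Fin (n + 2) => gK U r (β i) (α j))
  have e0 := key (n + 2) α id strictMono_id
  have e1 := key n (fun j => α ⟨(j : ℕ) + 1, by omega⟩) _ hm
  have e2 := key (n + 1) (fun j => α ⟨(j : ℕ), by omega⟩) _ hc
  have e3 := key (n + 1) (fun j => α ⟨(j : ℕ) + 1, by omega⟩) _ hs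
  have e4 := key (n + 1) (fun j => α ⟨(j : ℕ) + 1, by omega⟩) _ hc
  have e5 := key (n + 1) (fun j => α ⟨(j : ℕ), by omega⟩) _ hs
  refine Eq.trans (congrArg₂ (· * ·) e0 e1) (Eq.trans D (Eq.symm ?_))
  exact congrArg₂ (· - ·) (congrArg₂ (· * ·) e2 e3) (congrArg₂ (· * ·) e4 e5)
end
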